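/- arXiv:2507.01672 — 5 statements merged into one kernel-verified Lean document; each statement's English description precedes it below -/
import Mathlib

section
/- Let n ≥ 5 and let P = conv(v_1,…,v_n) be a convex polygon as in the context whose last four vertices are v_{n−2} = (−γ, γ), v_{n−1} = (−1, 1), v_n = (1, 1), v_1 = (γ, γ) for some real number γ > 1. Let P_{n−2} = conv(v_1, …, v_{n−2}) with adjoint α_{P_{n−2}}. Then there exists a nonzero real number λ such that α_P(t, 0) = λ · t² · α_{P_{n−2}}(t, 0) as univariate polynomials in t; in other words, on the line {x_2 = 0} (which is the adjoint line of the quadrilateral conv(v_1, v_{n−2}, v_{n−1}, v_n)) the restriction of α_P equals, up to nonzero scalar, t² times the restriction of α_{P_{n−2}}. -/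
open MvPolynomial

/-- The affine-linear form `l(x) = c + w₀ x₁ + w₁ x₂` with inward normal `w`. -/
noncomputable def linForm (w : Fin 2 → ℝ) (c : ℝ) : MvPolynomial (Fin 2) ℝ :=
  C c + C (w 0) * X 0 + C (w 1) * X 1

/-- Determinant of the 2×2 matrix with columns `a`, `b`. -/
def det2 (a b : Fin 2 → ℝ) : ℝ := a 0 * b 1 - a 1 * b 0

/-- Warren's adjoint polynomial of an `m`-gon with facet data `(w, c)` (indices `0,…,m-1`
read cyclically): `α(x) = Σᵢ det(wᵢ, wᵢ₊₁) Π_{j ∉ {i,i+1}} lⱼ(x)`. -/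
noncomputable def adjPoly (m : ℕ) (w : ℕ → Fin 2 → ℝ) (c : ℕ → ℝ) :
    MvPolynomial (Fin 2) ℝ :=
  ∑ i ∈ Finset.range m, C (det2 (w i) (w ((i + 1) % m))) *
    ∏ j ∈ ((Finset.range m).erase i).erase ((i + 1) % m), linForm (w j) (c j)

/-- `v 0, …, v (m-1)` are the vertices, in counterclockwise order, of a convex `m`-gon in
which every `v i` is a vertex, and for each `i` the affine-linear form
`lᵢ = linForm (w i) (c i)` vanishes on the edge from `v (i-1)` to `v i` and is strictly
positive at all the other vertices (hence on the interior of the polygon); counterclockwise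
orientation is recorded by `det(wᵢ, wᵢ₊₁) > 0`. -/
structure IsPolygonData (m : ℕ) (v w : ℕ → Fin 2 → ℝ) (c : ℕ → ℝ) : Prop where
  three_le : 3 ≤ m
  vanish_prev : ∀ i < m, eval (v ((i + m - 1) % m)) (linForm (w i) (c i)) = 0
  vanish_self : ∀ i < m, eval (v i) (linForm (w i) (c i)) = 0
  pos_other : ∀ i < m, ∀ j < m, j ≠ (i + m - 1) % m → j ≠ i →
    0 < eval (v j) (linForm (w i) (c i))
  ccw : ∀ i < m, 0 < det2 (w i) (w ((i + 1) % m))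

/-- `p` is (a representative of) the adjoint polynomial of the convex `m`-gon with
vertices `v 0, …, v (m-1)`, for some admissible choice of facet forms. -/
def IsAdjointOf (m : ℕ) (v : ℕ → Fin 2 → ℝ) (p : MvPolynomial (Fin 2) ℝ) : Prop :=
  ∃ w c, IsPolygonData m v w c ∧ p = adjPoly m w c

open Finset in
/-- Evaluation of the adjoint polynomial as a finite sum of real numbers. -/
theorem eval_adjPoly (m : ℕ) (w : ℕ → Fin 2 → ℝ) (c : ℕ → ℝ) (x : Fin 2 → ℝ) :
    eval x (adjPoly m w c) = ∑ i ∈ range m, det2 (w i) (w ((i + 1) % m)) *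
      ∏ j ∈ ((range m).erase i).erase ((i + 1) % m), eval x (linForm (w j) (c j)) := by
  simp [adjPoly]

theorem eval_linForm (w : Fin 2 → ℝ) (c : ℝ) (x : Fin 2 → ℝ) :
    eval x (linForm w c) = c + w 0 * x 0 + w 1 * x 1 := by
  simp [linForm]

theorem det2_smul_smul (r s : ℝ) (a b : Fin 2 → ℝ) :
    det2 (r • a) (s • b) = r * s * det2 a b := by
  simp only [det2, Pi.smul_apply, smul_eq_mul]
  ring

open Finset in
/-- Rescaling the facet forms rescales the adjoint by the product of the factors. -/
theorem eval_adjPoly_of_smul {m : ℕ} (hm : 2 ≤ m) {w w' : ℕ → Fin 2 → ℝ} {c c' : ℕ → ℝ}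
    {k : ℕ → ℝ} (h : ∀ i < m, w' i = k i • w i ∧ c' i = k i * c i) (x : Fin 2 → ℝ) :
    eval x (adjPoly m w' c') = (∏ i ∈ range m, k i) * eval x (adjPoly m w c) := by
  rw [eval_adjPoly, eval_adjPoly, mul_sum]
  refine sum_congr rfl fun i hi => ?_
  have him : i < m := mem_range.1 hi
  have hj : (i + 1) % m < m := Nat.mod_lt _ (by omega)
  have hne : (i + 1) % m ≠ i := by
    rcases Nat.lt_or_ge (i + 1) m with h1 | h1
    · rw [Nat.mod_eq_of_lt h1]; omega
    · rw [show i + 1 = m by omega, Nat.mod_self]; omega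
  have hmem : (i + 1) % m ∈ (range m).erase i := mem_erase.2 ⟨hne, mem_range.2 hj⟩
  rw [(h i him).1, (h _ hj).1, det2_smul_smul, ← mul_prod_erase _ k hi,
    ← mul_prod_erase _ k hmem]
  have hprod : ∏ j ∈ ((range m).erase i).erase ((i + 1) % m), eval x (linForm (w' j) (c' j)) =
      (∏ j ∈ ((range m).erase i).erase ((i + 1) % m), k j) *
        ∏ j ∈ ((range m).erase i).erase ((i + 1) % m), eval x (linForm (w j) (c j)) := by
    rw [← prod_mul_distrib]
    refine prod_congr rfl fun j hj => ?_
    have hjm : j < m := mem_range.1 (mem_of_mem_erase (mem_of_mem_erase hj))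
    rw [eval_linForm, eval_linForm, (h j hjm).1, (h j hjm).2]
    simp only [Pi.smul_apply, smul_eq_mul]
    ring
  rw [hprod]
  ring

/-- Two nonconstant affine-linear forms vanishing at two distinct points are proportional. -/
theorem exists_smul_of_vanish {p q w w' : Fin 2 → ℝ} {c c' : ℝ} (hpq : p ≠ q)
    (hw : w ≠ 0) (hw' : w' ≠ 0)
    (h₁ : eval p (linForm w c) = 0) (h₂ : eval q (linForm w c) = 0)
    (h₃ : eval p (linForm w' c') = 0) (h₄ : eval q (linForm w' c') = 0) :
    ∃ k : ℝ, k ≠ 0 ∧ w' = k • w ∧ c' = k * c := by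
  simp only [eval_linForm] at h₁ h₂ h₃ h₄
  have hdet : w 0 * w' 1 = w 1 * w' 0 := by
    by_contra hne
    have hne' : w 0 * w' 1 - w 1 * w' 0 ≠ 0 := sub_ne_zero.2 hne
    refine hpq (funext fun i => sub_eq_zero.1 (mul_left_cancel₀ hne' ?_))
    fin_cases i
    · simp only [Fin.zero_eta]
      linear_combination w' 1 * (h₁ - h₂) - w 1 * (h₃ - h₄)
    · simp only [Fin.mk_one]
      linear_combination w 0 * (h₃ - h₄) - w' 0 * (h₁ - h₂)
  obtain ⟨k, hk⟩ : ∃ k : ℝ, w' = k • w := by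
    by_cases h0 : w 0 = 0
    · have h1 : w 1 ≠ 0 := fun h1 => hw (funext fun i => by fin_cases i <;> simp [h0, h1])
      refine ⟨w' 1 / w 1, funext fun i => ?_⟩
      fin_cases i
      · have : w' 0 = 0 := by simpa [h0, h1] using hdet
        simp [h0, this]
      · simp [h1]
    · refine ⟨w' 0 / w 0, funext fun i => ?_⟩
      fin_cases i
      · simp [h0]
      · simp only [Fin.mk_one, Pi.smul_apply, smul_eq_mul]
        field_simp
        linarith
  refine ⟨k, ?_, hk, ?_⟩
  · rintro rfl
    exact hw' (by simpa using hk)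
  · have e0 : w' 0 = k * w 0 := by simp [hk]
    have e1 : w' 1 = k * w 1 := by simp [hk]
    rw [e0, e1] at h₃
    linear_combination h₃ - k * h₁

namespace IsPolygonData

variable {m : ℕ} {v w : ℕ → Fin 2 → ℝ} {c : ℕ → ℝ}

theorem normal_ne_zero (h : IsPolygonData m v w c) {i : ℕ} (hi : i < m) : w i ≠ 0 := by
  intro h0
  simpa [det2, h0] using h.ccw i hi

theorem vanish_pred (h : IsPolygonData m v w c) {i : ℕ} (hi : i + 1 < m) :
    eval (v i) (linForm (w (i + 1)) (c (i + 1))) = 0 := by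
  have := h.vanish_prev (i + 1) hi
  rwa [show i + 1 + m - 1 = i + m by omega, Nat.add_mod_right,
    Nat.mod_eq_of_lt (by omega)] at this

theorem vertex_ne_succ (h : IsPolygonData m v w c) {i : ℕ} (hi : i + 2 < m) :
    v i ≠ v (i + 1) := by
  intro he
  have hpos := h.pos_other (i + 2) hi i (by omega)
    (by rw [show i + 2 + m - 1 = i + 1 + m by omega, Nat.add_mod_right,
          Nat.mod_eq_of_lt (by omega)]; omega) (by omega)
  rw [he, h.vanish_pred hi] at hpos
  exact lt_irrefl _ hpos

end IsPolygonData

open Finset in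
/-- The part of the adjoint of an `m`-gon, `m ≥ k + 3`, coming from consecutive pairs among
the facets `1, …, k + 2`. -/
noncomputable def chainSum (k : ℕ) (w : ℕ → Fin 2 → ℝ) (c : ℕ → ℝ) (x : Fin 2 → ℝ) : ℝ :=
  ∑ i ∈ range (k + 1), det2 (w (i + 1)) (w (i + 2)) *
    ∏ j ∈ ((Ico 1 (k + 3)).erase (i + 1)).erase (i + 2), eval x (linForm (w j) (c j))

open Finset in
theorem eval_adjPoly_add_three (k : ℕ) (w : ℕ → Fin 2 → ℝ) (c : ℕ → ℝ) (x : Fin 2 → ℝ) :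
    eval x (adjPoly (k + 3) w c) =
      chainSum k w c x * eval x (linForm (w 0) (c 0)) +
      det2 (w 0) (w 1) * ∏ j ∈ Ico 2 (k + 3), eval x (linForm (w j) (c j)) +
      det2 (w (k + 2)) (w 0) * ∏ j ∈ Ico 1 (k + 2), eval x (linForm (w j) (c j)) := by
  rw [eval_adjPoly, sum_range_succ, sum_range_succ', chainSum, sum_mul]
  congr 1
  · congr 1
    · refine sum_congr rfl fun i hi => ?_
      have hi := mem_range.1 hi
      rw [Nat.mod_eq_of_lt (show i + 1 + 1 < k + 3 by omega),
        show ((range (k + 3)).erase (i + 1)).erase (i + 1 + 1) =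
          insert 0 (((Ico 1 (k + 3)).erase (i + 1)).erase (i + 2)) by
            ext j; simp only [mem_erase, mem_range, mem_insert, mem_Ico]; omega,
        prod_insert (by simp)]
      ring
    · rw [Nat.mod_eq_of_lt (by omega),
        show ((range (k + 3)).erase 0).erase (0 + 1) = Ico 2 (k + 3) by
          ext j; simp only [mem_erase, mem_range, mem_Ico]; omega]
  · rw [show (k + 2 + 1) % (k + 3) = 0 from Nat.mod_self _,
      show ((range (k + 3)).erase (k + 2)).erase 0 = Ico 1 (k + 2) by
        ext j; simp only [mem_erase, mem_range, mem_Ico]; omega]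

open Finset in
theorem eval_adjPoly_add_five (k : ℕ) (w : ℕ → Fin 2 → ℝ) (c : ℕ → ℝ) (x : Fin 2 → ℝ) :
    eval x (adjPoly (k + 5) w c) =
      chainSum k w c x * (eval x (linForm (w 0) (c 0)) *
        eval x (linForm (w (k + 3)) (c (k + 3))) * eval x (linForm (w (k + 4)) (c (k + 4)))) +
      det2 (w 0) (w 1) * (eval x (linForm (w (k + 3)) (c (k + 3))) *
        eval x (linForm (w (k + 4)) (c (k + 4))) *
        ∏ j ∈ Ico 2 (k + 3), eval x (linForm (w j) (c j))) +
      det2 (w (k + 2)) (w (k + 3)) * (eval x (linForm (w 0) (c 0)) *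
        eval x (linForm (w (k + 4)) (c (k + 4))) *
        ∏ j ∈ Ico 1 (k + 2), eval x (linForm (w j) (c j))) +
      det2 (w (k + 3)) (w (k + 4)) * (eval x (linForm (w 0) (c 0)) *
        ∏ j ∈ Ico 1 (k + 3), eval x (linForm (w j) (c j))) +
      det2 (w (k + 4)) (w 0) * (eval x (linForm (w (k + 3)) (c (k + 3))) *
        ∏ j ∈ Ico 1 (k + 3), eval x (linForm (w j) (c j))) := by
  rw [eval_adjPoly, sum_range_succ, sum_range_succ, sum_range_succ, sum_range_succ', chainSum,
    sum_mul]
  congr 1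
  · congr 1
    · congr 1
      · congr 1
        · refine sum_congr rfl fun i hi => ?_
          have hi := mem_range.1 hi
          rw [Nat.mod_eq_of_lt (show i + 1 + 1 < k + 5 by omega),
            show ((range (k + 5)).erase (i + 1)).erase (i + 1 + 1) =
              insert 0 (insert (k + 3) (insert (k + 4)
                (((Ico 1 (k + 3)).erase (i + 1)).erase (i + 2)))) by
              ext j; simp only [mem_erase, mem_range, mem_insert, mem_Ico]; omega,
            prod_insert (by simp), prod_insert (by simp), prod_insert (by simp)]
          ring
        · rw [Nat.mod_eq_of_lt (by omega),
            show ((range (k + 5)).erase 0).erase (0 + 1) =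
              insert (k + 3) (insert (k + 4) (Ico 2 (k + 3))) by
              ext j; simp only [mem_erase, mem_range, mem_insert, mem_Ico]; omega,
            prod_insert (by simp), prod_insert (by simp)]
          ring
      · rw [Nat.mod_eq_of_lt (by omega),
          show ((range (k + 5)).erase (k + 2)).erase (k + 2 + 1) =
            insert 0 (insert (k + 4) (Ico 1 (k + 2))) by
            ext j; simp only [mem_erase, mem_range, mem_insert, mem_Ico]; omega,
          prod_insert (by simp), prod_insert (by simp)]
        ring
    · rw [Nat.mod_eq_of_lt (by omega),
        show ((range (k + 5)).erase (k + 3)).erase (k + 3 + 1) = insert 0 (Ico 1 (k + 3)) by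
          ext j; simp only [mem_erase, mem_range, mem_insert, mem_Ico]; omega,
        prod_insert (by simp)]
  · rw [show (k + 4 + 1) % (k + 5) = 0 from Nat.mod_self _,
      show ((range (k + 5)).erase (k + 4)).erase 0 = insert (k + 3) (Ico 1 (k + 3)) by
        ext j; simp only [mem_erase, mem_range, mem_insert, mem_Ico]; omega,
      prod_insert (by simp)]

theorem chainSum_update_zero (k : ℕ) (w : ℕ → Fin 2 → ℝ) (c : ℕ → ℝ) (u : Fin 2 → ℝ) (d : ℝ)
    (x : Fin 2 → ℝ) :
    chainSum k (Function.update w 0 u) (Function.update c 0 d) x = chainSum k w c x := by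
  refine Finset.sum_congr rfl fun i _ => ?_
  rw [Function.update_of_ne (by omega), Function.update_of_ne (by omega)]
  congr 1
  refine Finset.prod_congr rfl fun j hj => ?_
  have hj : j ≠ 0 := by
    have := (Finset.mem_Ico.1 (Finset.mem_of_mem_erase (Finset.mem_of_mem_erase hj))).1
    omega
  rw [Function.update_of_ne hj, Function.update_of_ne hj]

open Finset in
/-- Cutting off the quadrilateral with vertices `(-γ, γ), (-1, 1), (1, 1), (γ, γ)`: restriction
of the adjoint to the line `x₂ = 0`, with the last facet of the subpolygon normalised to
`x₂ - γ`. -/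
theorem eval_adjPoly_cut {k : ℕ} {γ : ℝ} (hγ : γ ≠ 0) {w : ℕ → Fin 2 → ℝ} {c : ℕ → ℝ}
    {a b e : ℝ} (hw0 : w 0 = ![-a, a]) (hc0 : c 0 = 0)
    (hw3 : w (k + 3) = ![b, b]) (hc3 : c (k + 3) = 0)
    (hw4 : w (k + 4) = ![0, e]) (hc4 : c (k + 4) = -e)
    (h1 : eval ![γ, γ] (linForm (w 1) (c 1)) = 0)
    (h2 : eval ![-γ, γ] (linForm (w (k + 2)) (c (k + 2))) = 0) (t : ℝ) :
    eval ![t, 0] (adjPoly (k + 5) w c) = -(a * b * e / γ) * t ^ 2 *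
      eval ![t, 0] (adjPoly (k + 3) (Function.update w 0 ![0, 1])
        (Function.update c 0 (-γ))) := by
  have hprod : ∀ r s : ℕ, 1 ≤ r →
      ∏ j ∈ Ico r s, eval ![t, 0] (linForm (Function.update w 0 ![0, 1] j)
        (Function.update c 0 (-γ) j)) = ∏ j ∈ Ico r s, eval ![t, 0] (linForm (w j) (c j)) := by
    intro r s hr
    refine prod_congr rfl fun j hj => ?_
    have hj : j ≠ 0 := by have := (mem_Ico.1 hj).1; omega
    rw [Function.update_of_ne hj, Function.update_of_ne hj]
  rw [eval_adjPoly_add_five, eval_adjPoly_add_three, chainSum_update_zero,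
    hprod 2 _ (by omega), hprod 1 _ (by omega), Function.update_self, Function.update_self,
    Function.update_of_ne (by omega), Function.update_of_ne (by omega)]
  have hA : ∏ j ∈ Ico 1 (k + 3), eval ![t, 0] (linForm (w j) (c j)) =
      eval ![t, 0] (linForm (w 1) (c 1)) *
        ∏ j ∈ Ico 2 (k + 3), eval ![t, 0] (linForm (w j) (c j)) :=
    prod_eq_prod_Ico_succ_bot (by omega) _
  have hB : ∏ j ∈ Ico 1 (k + 3), eval ![t, 0] (linForm (w j) (c j)) =
      (∏ j ∈ Ico 1 (k + 2), eval ![t, 0] (linForm (w j) (c j))) *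
        eval ![t, 0] (linForm (w (k + 2)) (c (k + 2))) :=
    prod_Ico_succ_top (by omega) _
  have hAB := hA.symm.trans hB
  generalize ∏ j ∈ Ico 1 (k + 3), eval ![t, 0] (linForm (w j) (c j)) = Q
  generalize ∏ j ∈ Ico 2 (k + 3), eval ![t, 0] (linForm (w j) (c j)) = A at *
  generalize ∏ j ∈ Ico 1 (k + 2), eval ![t, 0] (linForm (w j) (c j)) = B at *
  generalize chainSum k w c ![t, 0] = S
  simp only [eval_linForm, hw0, hc0, hw3, hc3, hw4, hc4, det2, Matrix.cons_val_zero,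
    Matrix.cons_val_one] at *
  field_simp
  linear_combination (-(a * b * e * t)) * hAB + a * b * e * t * A * h1 - a * b * e * t * B * h2

/- Vertices are indexed `0, …, n-1`, so the paper's vertices `v_{n-2}, v_{n-1}, v_n, v_1`
are `v (n-3), v (n-2), v (n-1), v 0` here, and the paper's subpolygon
`P_{n-2} = conv(v_1, …, v_{n-2})` is the polygon on the first `n-2` vertices. -/
theorem stmt_8 (n : ℕ) (hn : 5 ≤ n) (γ : ℝ) (hγ : 1 < γ)
    (v w : ℕ → Fin 2 → ℝ) (c : ℕ → ℝ)
    (hP : IsPolygonData n v w c)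
    (hv1 : v (n - 3) = ![-γ, γ]) (hv2 : v (n - 2) = ![-1, 1])
    (hv3 : v (n - 1) = ![1, 1]) (hv4 : v 0 = ![γ, γ])
    (α' : MvPolynomial (Fin 2) ℝ) (hα' : IsAdjointOf (n - 2) v α') :
    ∃ lam : ℝ, lam ≠ 0 ∧ ∀ t : ℝ,
      eval ![t, 0] (adjPoly n w c) = lam * t ^ 2 * eval ![t, 0] α' := by
  obtain ⟨k, rfl⟩ : ∃ k, n = k + 5 := ⟨n - 5, by omega⟩
  obtain ⟨w', c', hP', rfl⟩ := hα'
  have hγ0 : γ ≠ 0 := by positivity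
  simp only [show k + 5 - 3 = k + 2 by omega, show k + 5 - 2 = k + 3 by omega,
    show k + 5 - 1 = k + 4 by omega] at hv1 hv2 hv3 hP' ⊢
  -- The three facets of the cut-off quadrilateral that belong to the polygon.
  obtain ⟨a, ha, hwa, hca⟩ := exists_smul_of_vanish (p := ![1, 1]) (q := ![γ, γ])
    (w := ![-1, 1]) (c := 0) (w' := w 0) (c' := c 0)
    (fun h => hγ.ne (by simpa using congrFun h 0))
    (fun h => by simpa using congrFun h 1) (hP.normal_ne_zero (by omega))
    (by simp [eval_linForm]) (by simp [eval_linForm])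
    (by
      have := hP.vanish_prev 0 (by omega)
      rwa [show (0 + (k + 5) - 1) % (k + 5) = k + 4 by
        rw [show 0 + (k + 5) - 1 = k + 4 by omega, Nat.mod_eq_of_lt (by omega)], hv3] at this)
    (by simpa only [hv4] using hP.vanish_self 0 (by omega))
  obtain ⟨b, hb, hwb, hcb⟩ := exists_smul_of_vanish (p := ![-γ, γ]) (q := ![-1, 1])
    (w := ![1, 1]) (c := 0) (w' := w (k + 3)) (c' := c (k + 3))
    (fun h => hγ.ne' (by simpa using congrFun h 0))
    (fun h => by simpa using congrFun h 1) (hP.normal_ne_zero (by omega))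
    (by simp [eval_linForm]) (by simp [eval_linForm])
    (by simpa only [hv1] using hP.vanish_pred (i := k + 2) (by omega))
    (by simpa only [hv2] using hP.vanish_self (k + 3) (by omega))
  obtain ⟨e, he, hwe, hce⟩ := exists_smul_of_vanish (p := ![-1, 1]) (q := ![1, 1])
    (w := ![0, 1]) (c := -1) (w' := w (k + 4)) (c' := c (k + 4))
    (fun h => by have := congrFun h 0; norm_num at this)
    (fun h => by simpa using congrFun h 1) (hP.normal_ne_zero (by omega))
    (by simp [eval_linForm]) (by simp [eval_linForm])
    (by simpa only [hv2] using hP.vanish_pred (i := k + 3) (by omega))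
    (by simpa only [hv3] using hP.vanish_self (k + 4) (by omega))
  -- The facets of the subpolygon.
  have hscale : ∀ i, ∃ r : ℝ, r ≠ 0 ∧ (i < k + 3 →
      w' i = r • Function.update w 0 ![0, 1] i ∧ c' i = r * Function.update c 0 (-γ) i) := by
    intro i
    by_cases hi : i < k + 3
    swap
    · exact ⟨1, one_ne_zero, fun h => absurd h hi⟩
    rcases i with _ | i
    · obtain ⟨r, hr, hwr, hcr⟩ := exists_smul_of_vanish (p := ![-γ, γ]) (q := ![γ, γ])
        (w := ![0, 1]) (c := -γ) (w' := w' 0) (c' := c' 0)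
        (fun h => by
          have h0 : -γ = γ := by simpa using congrFun h 0
          linarith)
        (fun h => by simpa using congrFun h 1) (hP'.normal_ne_zero (by omega))
        (by simp [eval_linForm]) (by simp [eval_linForm])
        (by
          have := hP'.vanish_prev 0 (by omega)
          rwa [show (0 + (k + 3) - 1) % (k + 3) = k + 2 by
            rw [show 0 + (k + 3) - 1 = k + 2 by omega, Nat.mod_eq_of_lt (by omega)],
            hv1] at this)
        (by simpa only [hv4] using hP'.vanish_self 0 (by omega))
      exact ⟨r, hr, fun _ => by simpa only [Function.update_self] using ⟨hwr, hcr⟩⟩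
    · obtain ⟨r, hr, hwr, hcr⟩ := exists_smul_of_vanish
        (hP.vertex_ne_succ (i := i) (by omega)) (hP.normal_ne_zero (i := i + 1) (by omega))
        (hP'.normal_ne_zero hi) (hP.vanish_pred (by omega)) (hP.vanish_self _ (by omega))
        (hP'.vanish_pred hi) (hP'.vanish_self _ hi)
      refine ⟨r, hr, fun _ => ?_⟩
      rw [Function.update_of_ne (by omega), Function.update_of_ne (by omega)]
      exact ⟨hwr, hcr⟩
  choose r hr hwr using hscale
  have hR : ∏ i ∈ Finset.range (k + 3), r i ≠ 0 := Finset.prod_ne_zero_iff.2 fun i _ => hr i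
  refine ⟨-(a * b * e / γ) / ∏ i ∈ Finset.range (k + 3), r i,
    div_ne_zero (neg_ne_zero.2 (by positivity)) hR, fun t => ?_⟩
  rw [eval_adjPoly_of_smul (by omega) hwr,
    eval_adjPoly_cut (a := a) (b := b) (e := e) hγ0 (by simp [hwa]) (by simp [hca])
      (by simp [hwb]) (by simp [hcb]) (by simp [hwe]) (by simp [hce])
      (by simpa only [hv4] using hP.vanish_pred (i := 0) (by omega))
      (by simpa only [hv1] using hP.vanish_self (k + 2) (by omega))]
  field_simp
end

section
/- Let C be a line arrangement in ℙ³(ℂ) that is nice for degree D (D ≥ 1). Then the smallest degree of a nonzero homogeneous polynomial in ℂ[x_0, x_1, x_2, x_3] vanishing on every line of C is exactly D − 1; that is: (a) every homogeneous polynomial of degree at most D − 2 that vanishes at every point of every line of C is the zero polynomial, and (b) there exists a nonzero homogeneous polynomial of degree D − 1 vanishing at every point of every line of C. -/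
/-- A line in `ℙ³(ℂ)`, identified with a 2-dimensional linear subspace of `ℂ⁴`. -/
def IsLine (L : Submodule ℂ (Fin 4 → ℂ)) : Prop := Module.finrank ℂ L = 2

/-- A plane in `ℙ³(ℂ)`, identified with a 3-dimensional linear subspace of `ℂ⁴`. -/
def IsPlane (H : Submodule ℂ (Fin 4 → ℂ)) : Prop := Module.finrank ℂ H = 3

/-- `Nice D C`: the line arrangement `C` in `ℙ³(ℂ)` is nice for degree `D`
(Definition `def:nicearrangements`). The empty arrangement is the only arrangement nice
for degree `1`; an arrangement is nice for degree `D+1` if it is the union of an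
arrangement `Y` nice for degree `D` and a set `Z` of `D` pairwise disjoint lines, none in
`Y`, each meeting exactly `D-1` lines of `Y`, such that for some plane `H` the lines not
contained in `H` form an arrangement nice for degree `D`, and no three lines of the
arrangement meet in a point. -/
inductive Nice : ℕ → Set (Submodule ℂ (Fin 4 → ℂ)) → Prop
  | base : Nice 1 ∅
  | step (D : ℕ) (Y Z : Set (Submodule ℂ (Fin 4 → ℂ))) (H : Submodule ℂ (Fin 4 → ℂ)) :
      Nice D Y →
      (∀ L ∈ Z, IsLine L) →
      Z.ncard = D →
      (∀ L ∈ Z, ∀ L' ∈ Z, L ≠ L' → L ⊓ L' = ⊥) →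
      (∀ L ∈ Z, L ∉ Y) →
      (∀ L ∈ Z, {L' ∈ Y | L ⊓ L' ≠ ⊥}.ncard = D - 1) →
      IsPlane H →
      Nice D {L ∈ Y ∪ Z | ¬ L ≤ H} →
      (∀ L₁ ∈ Y ∪ Z, ∀ L₂ ∈ Y ∪ Z, ∀ L₃ ∈ Y ∪ Z, L₁ ≠ L₂ → L₁ ≠ L₃ → L₂ ≠ L₃ →
        L₁ ⊓ L₂ ⊓ L₃ = ⊥) →
      Nice (D + 1) (Y ∪ Z)

section PolynomialsOnSubspaces

open MvPolynomial Module

variable {K σ : Type*} [Field K]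

theorem eval_aeval_eq_eval {τ : Type*} (g : σ → MvPolynomial τ K) (f : MvPolynomial σ K)
    (x : τ → K) : eval x (aeval g f) = eval (fun i => eval x (g i)) f := by
  rw [← coe_aeval_eq_eval, RingHom.coe_coe, ← AlgHom.comp_apply, comp_aeval]
  rfl

/-- The total degree does not increase under a substitution by linear forms. -/
theorem totalDegree_aeval_le_of_isHomogeneous_one {τ : Type*} (g : σ → MvPolynomial τ K)
    (hg : ∀ i, (g i).IsHomogeneous 1) (f : MvPolynomial σ K) :
    (aeval g f).totalDegree ≤ f.totalDegree := by
  conv_lhs => rw [← sum_homogeneousComponent f, map_sum]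
  refine totalDegree_finsetSum_le fun i hi => ?_
  have h := ((homogeneousComponent_isHomogeneous i f).aeval g hg).totalDegree_le
  rw [Finset.mem_range] at hi
  lia

/-- A polynomial vanishing on the kernel of a nonzero linear form is divisible by that form. -/
theorem dvd_of_eval_eq_zero_on_ker [Infinite K] {φ : (σ → K) →ₗ[K] K} (hφ : φ ≠ 0) {h : MvPolynomial σ K}
    (hh : ∀ x, eval x h = φ x) {f : MvPolynomial σ K}
    (hf : ∀ x ∈ LinearMap.ker φ, eval x f = 0) : h ∣ f := by
  obtain ⟨v, hv⟩ := LinearMap.surjective hφ 1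
  have h0 : aeval (fun i => X i - C (v i) * h) f = 0 := by
    refine MvPolynomial.funext fun x => ?_
    have hx : x - φ x • v ∈ LinearMap.ker φ := by simp [hv]
    rw [map_zero, ← hf _ hx, eval_aeval_eq_eval]
    congr 2
    ext i
    simp [hh, mul_comm]
  rw [← Ideal.mem_span_singleton, ← Ideal.Quotient.eq_zero_iff_mem,
    ← map_zero (Ideal.Quotient.mk (Ideal.span {h})), ← h0, ← Ideal.Quotient.mkₐ_eq_mk K, ← AlgHom.comp_apply]
  refine DFunLike.congr_fun (?_ : Ideal.Quotient.mkₐ K (Ideal.span {h}) = _) f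
  ext i
  have : (Ideal.Quotient.mk (Ideal.span {h})) h = 0 :=
    Ideal.Quotient.eq_zero_iff_mem.2 (Ideal.mem_span_singleton_self h)
  simp [this]

variable [Fintype σ]

theorem eval_smul_of_isHomogeneous {f : MvPolynomial σ K} {d : ℕ} (hf : f.IsHomogeneous d)
    (c : K) (x : σ → K) : eval (c • x) f = c ^ d * eval x f := by
  rw [eval_eq', eval_eq', Finset.mul_sum]
  refine Finset.sum_congr rfl fun m hm => ?_
  have hd : ∑ i, m i = d := by
    rw [← hf (mem_support_iff.1 hm), Finsupp.weight_apply, Finsupp.sum_fintype _ _ (by simp)]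
    simp
  simp only [Pi.smul_apply, smul_eq_mul, mul_pow, Finset.prod_mul_distrib,
    Finset.prod_pow_eq_pow_sum, hd]
  ring

/-- A linear form on `K^σ`, as a homogeneous polynomial of degree one. -/
theorem exists_isHomogeneous_one_eval_eq (φ : (σ → K) →ₗ[K] K) :
    ∃ h : MvPolynomial σ K, h.IsHomogeneous 1 ∧ ∀ x, eval x h = φ x := by
  classical
  refine ⟨∑ i, C (φ (Pi.single i 1)) * X i,
    IsHomogeneous.sum _ _ _ fun i _ => (isHomogeneous_X K i).C_mul _, fun x => ?_⟩
  conv_rhs => rw [pi_eq_sum_univ' x]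
  simp [mul_comm]

/-- Precomposition of a polynomial function with a linear endomorphism. -/
theorem exists_eval_eq_eval_linearMap (π : (σ → K) →ₗ[K] (σ → K)) (f : MvPolynomial σ K) :
    ∃ g : MvPolynomial σ K, g.totalDegree ≤ f.totalDegree ∧ ∀ x, eval x g = eval (π x) f := by
  choose h hh he using fun i => exists_isHomogeneous_one_eval_eq (LinearMap.proj i ∘ₗ π)
  refine ⟨aeval h f, totalDegree_aeval_le_of_isHomogeneous_one h hh f, fun x => ?_⟩
  rw [eval_aeval_eq_eval]
  simp only [he]
  rfl

theorem isCoatom_of_finrank_add_one_eq {V : Type*} [AddCommGroup V] [Module K V]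
    [FiniteDimensional K V] {W : Submodule K V} (hW : finrank K W + 1 = finrank K V) :
    IsCoatom W := by
  refine ⟨fun h => ?_, fun M hM => ?_⟩
  · rw [h, finrank_top] at hW
    lia
  · have := Submodule.finrank_lt_finrank_of_lt hM
    exact Submodule.eq_top_of_finrank_eq (le_antisymm (Submodule.finrank_le M) (by lia))

variable [Infinite K]

/-- Subspaces are irreducible: if `h * g` vanishes on `W` but `h` does not, then `g` does. -/
theorem eval_eq_zero_on_submodule_of_mul {W : Submodule K (σ → K)} {h g : MvPolynomial σ K}
    (hW : ∀ x ∈ W, eval x (h * g) = 0) {y : σ → K} (hyW : y ∈ W) (hy : eval y h ≠ 0) :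
    ∀ x ∈ W, eval x g = 0 := by
  intro x hx
  let r : MvPolynomial σ K →ₐ[K] Polynomial K :=
    aeval fun i => Polynomial.C (y i) + Polynomial.X * Polynomial.C (x i - y i)
  have hr : ∀ (t : K) (p : MvPolynomial σ K), (r p).eval t = eval (y + t • (x - y)) p := by
    intro t p
    simp only [r, aeval_def, eval₂_eq', Polynomial.eval_finsetSum, Polynomial.eval_mul,
      Polynomial.eval_prod, eval_eq']
    simp
  have hz : r h * r g = 0 := by
    rw [← map_mul]
    refine Polynomial.funext fun t => ?_
    rw [hr, hW _ (W.add_mem hyW (W.smul_mem _ (W.sub_mem hx hyW))), Polynomial.eval_zero]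
  rcases mul_eq_zero.1 hz with h0 | h0
  · have := hr 0 h
    simp [h0] at this
    exact absurd this.symm hy
  · have := hr 1 g
    simpa [h0, eq_comm] using this

/-- Dividing out a linear form: if `f ≠ 0` vanishes on a hyperplane `H`, there is a polynomial `g`
of smaller degree vanishing on every subspace not contained in `H` on which `f` vanishes. -/
theorem exists_totalDegree_lt_of_isCoatom {H : Submodule K (σ → K)} (hH : IsCoatom H)
    {f : MvPolynomial σ K} (hf0 : f ≠ 0) (hf : ∀ x ∈ H, eval x f = 0) :
    ∃ g : MvPolynomial σ K, g ≠ 0 ∧ g.totalDegree + 1 = f.totalDegree ∧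
      ∀ W : Submodule K (σ → K), ¬ W ≤ H → (∀ x ∈ W, eval x f = 0) → ∀ x ∈ W, eval x g = 0 := by
  obtain ⟨φ, hφ0, hφ⟩ := Submodule.exists_le_ker_of_lt_top H hH.lt_top
  have hker : H = LinearMap.ker φ :=
    (hH.le_iff_eq (by rwa [Ne, LinearMap.ker_eq_top])).1 hφ |>.symm
  obtain ⟨h, hh1, hh⟩ := exists_isHomogeneous_one_eval_eq φ
  obtain ⟨g, rfl⟩ := dvd_of_eval_eq_zero_on_ker hφ0 hh (hker ▸ hf)
  refine ⟨g, right_ne_zero_of_mul hf0, ?_, fun W hW hWf => ?_⟩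
  · rw [totalDegree_mul_of_isDomain (left_ne_zero_of_mul hf0) (right_ne_zero_of_mul hf0),
      hh1.totalDegree (left_ne_zero_of_mul hf0), add_comm]
  · obtain ⟨y, hyW, hy⟩ := Set.not_subset.1 hW
    refine eval_eq_zero_on_submodule_of_mul hWf hyW ?_
    rw [hh]
    rwa [SetLike.mem_coe, hker, LinearMap.mem_ker] at hy

/-- A polynomial vanishing on more hyperplanes than its degree is zero. -/
theorem eq_zero_of_totalDegree_lt_card_isCoatom (S : Finset (Submodule K (σ → K)))
    (hS : ∀ W ∈ S, IsCoatom W) (f : MvPolynomial σ K) (hd : f.totalDegree < S.card)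
    (hf : ∀ W ∈ S, ∀ x ∈ W, eval x f = 0) : f = 0 := by
  classical
  induction S using Finset.induction_on generalizing f with
  | empty => simp at hd
  | insert H S hHS ih =>
    by_contra hf0
    obtain ⟨g, hg0, hgd, hg⟩ := exists_totalDegree_lt_of_isCoatom (hS H (by simp)) hf0
      (hf H (by simp))
    rw [Finset.card_insert_of_notMem hHS] at hd
    refine hg0 (ih (fun W hW => hS W (by simp [hW])) g (by lia) fun W hW => ?_)
    refine hg W (fun hle => hHS ?_) (hf W (by simp [hW]))
    rwa [← (hS W (by simp [hW])).le_iff_eq (hS H (by simp)).ne_top |>.1 hle] at hW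

/-- A polynomial vanishing on more hyperplanes of a subspace `L` than its degree vanishes
on `L`. -/
theorem eval_eq_zero_of_totalDegree_lt_card {L : Submodule K (σ → K)}
    (S : Finset (Submodule K (σ → K))) (hSL : ∀ W ∈ S, W ≤ L)
    (hS : ∀ W ∈ S, finrank K W + 1 = finrank K L)
    (f : MvPolynomial σ K) (hd : f.totalDegree < S.card)
    (hf : ∀ W ∈ S, ∀ x ∈ W, eval x f = 0) : ∀ x ∈ L, eval x f = 0 := by
  classical
  obtain ⟨π, hπ⟩ := L.subtype.exists_leftInverse_of_injective L.ker_subtype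
  have hπx : ∀ x (hx : x ∈ L), π x = ⟨x, hx⟩ := fun x hx =>
    LinearMap.congr_fun hπ ⟨x, hx⟩
  have hsurj : Function.Surjective π := fun x => ⟨x, hπx x x.2⟩
  obtain ⟨g, hgd, hg⟩ := exists_eval_eq_eval_linearMap (L.subtype ∘ₗ π) f
  let c : Submodule K (σ → K) → Submodule K (σ → K) := fun W => (W.submoduleOf L).comap π
  have hinj : Set.InjOn c S := by
    intro W hW W' hW' h
    have := Submodule.comap_injective_of_surjective hsurj h
    rw [← inf_eq_left.2 (hSL W hW), ← inf_eq_left.2 (hSL W' hW')]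
    rw [inf_comm, ← Submodule.map_comap_subtype, inf_comm W', ← Submodule.map_comap_subtype]
    exact congrArg _ this
  have hcoatom : ∀ W ∈ S, IsCoatom (c W) := by
    intro W hW
    refine (Submodule.isCoatom_comap_iff hsurj).2 (isCoatom_of_finrank_add_one_eq ?_)
    rw [← hS W hW]
    exact congrArg (· + 1) (Submodule.submoduleOfEquivOfLe (hSL W hW)).finrank_eq
  have hg0 : g = 0 := by
    refine eq_zero_of_totalDegree_lt_card_isCoatom (S.image c) ?_ g ?_ ?_
    · simpa using hcoatom
    · rw [Finset.card_image_of_injOn hinj]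
      lia
    · intro W hW x hx
      obtain ⟨W, hWS, rfl⟩ := Finset.mem_image.1 hW
      rw [hg]
      exact hf W hWS _ hx
  intro x hx
  have := hg x
  rw [hg0] at this
  simpa [hπx x hx, eq_comm] using this

/-- A form of degree `d` vanishes on a two-dimensional subspace `L` as soon as it vanishes on `d + 1`
one-dimensional subspaces of `L`; if a set `A` of such is prescribed, the others can be replaced
by suitable points. -/
theorem exists_finset_forall_eval_eq_zero_of_finrank_eq_two {L : Submodule K (σ → K)}
    (hL : finrank K L = 2) (A : Finset (Submodule K (σ → K)))
    (hA : ∀ W ∈ A, W ≤ L ∧ finrank K W = 1) (d : ℕ) :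
    ∃ P : Finset (σ → K), P.card ≤ d + 1 - A.card ∧
      ∀ f : MvPolynomial σ K, f.IsHomogeneous d → (∀ W ∈ A, ∀ x ∈ W, eval x f = 0) →
        (∀ p ∈ P, eval p f = 0) → ∀ x ∈ L, eval x f = 0 := by
  classical
  let b := finBasisOfFinrankEq K L hL
  have hb : ∀ s t : K, s • (b 0 : σ → K) + t • (b 1 : σ → K) = 0 → s = 0 ∧ t = 0 := by
    intro s t h
    have hli := Fintype.linearIndependent_iff.1 b.linearIndependent ![s, t]
      (by simpa [Fin.sum_univ_two, Subtype.ext_iff] using h)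
    exact ⟨hli 0, hli 1⟩
  let w : K → σ → K := fun t => b 0 + t • (b 1 : σ → K)
  have hw0 : ∀ t, w t ≠ 0 := fun t h => by
    have := hb 1 t (by simpa [w] using h)
    exact one_ne_zero this.1
  have hwL : ∀ t, w t ∈ L := fun t => L.add_mem (b 0).2 (L.smul_mem _ (b 1).2)
  let l : K → Submodule K (σ → K) := fun t => Submodule.span K {w t}
  have hl : Function.Injective l := by
    intro t s h
    have hm : w t ∈ l s := h ▸ Submodule.mem_span_singleton_self (w t)
    obtain ⟨c, hc⟩ := Submodule.mem_span_singleton.1 hm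
    have := hb (c - 1) (c * s - t) (by
      rw [← sub_eq_zero] at hc
      rw [← hc]
      simp only [w]
      module)
    rw [sub_eq_zero.1 this.1, one_mul] at this
    exact (sub_eq_zero.1 this.2).symm
  obtain ⟨T, hT, hTc⟩ :=
    (A.finite_toSet.preimage hl.injOn).infinite_compl.exists_subset_card_eq (d + 1 - A.card)
  refine ⟨T.image w, hTc ▸ Finset.card_image_le, fun f hf hfA hfT => ?_⟩
  have hdisj : Disjoint A (T.image l) := by
    rw [Finset.disjoint_right]
    intro W hW hWA
    obtain ⟨t, ht, rfl⟩ := Finset.mem_image.1 hW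
    exact hT ht hWA
  have hprop : ∀ W ∈ A ∪ T.image l, W ≤ L ∧ finrank K W = 1 := by
    intro W hW
    rcases Finset.mem_union.1 hW with hW | hW
    · exact hA W hW
    · obtain ⟨t, ht, rfl⟩ := Finset.mem_image.1 hW
      exact ⟨by simpa [l] using hwL t, finrank_span_singleton (hw0 t)⟩
  refine eval_eq_zero_of_totalDegree_lt_card (A ∪ T.image l) (fun W hW => (hprop W hW).1)
    (fun W hW => by rw [(hprop W hW).2, hL]) f ?_ fun W hW => ?_
  · rw [Finset.card_union_of_disjoint hdisj, Finset.card_image_of_injective _ hl, hTc]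
    have := hf.totalDegree_le
    lia
  · rcases Finset.mem_union.1 hW with hW | hW
    · exact hfA W hW
    · obtain ⟨t, ht, rfl⟩ := Finset.mem_image.1 hW
      intro x hx
      obtain ⟨c, rfl⟩ := Submodule.mem_span_singleton.1 hx
      rw [eval_smul_of_isHomogeneous hf, hfT _ (Finset.mem_image_of_mem w ht), mul_zero]

omit [Infinite K] in
/-- There is a nonzero form of degree `d` vanishing at the points of `P` if `P` has fewer elements
than there are monomials of degree `d`. -/
theorem exists_isHomogeneous_ne_zero_of_card_lt (d : ℕ) (P : Finset (σ → K))
    (hP : P.card < (Fintype.card σ + d - 1).choose d) :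
    ∃ f : MvPolynomial σ K, f ≠ 0 ∧ f.IsHomogeneous d ∧ ∀ p ∈ P, eval p f = 0 := by
  classical
  let I : Finset (σ →₀ ℕ) := Finset.univ.finsuppAntidiag d
  let Φ : (I → K) →ₗ[K] MvPolynomial σ K :=
    Fintype.linearCombination K fun i : I => monomial (i : σ →₀ ℕ) (1 : K)
  let E : (I → K) →ₗ[K] (P → K) :=
    LinearMap.pi fun p => (aeval (p : σ → K)).toLinearMap ∘ₗ Φ
  have hE : LinearMap.ker E ≠ ⊥ := by
    apply LinearMap.ker_ne_bot_of_finrank_lt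
    simpa [I, Finset.card_finsuppAntidiag_nat_eq_choose] using hP
  obtain ⟨c, hc, hc0⟩ := Submodule.exists_mem_ne_zero_of_ne_bot hE
  have hΦ : Φ c = ∑ i : I, monomial (i : σ →₀ ℕ) (c i) := by
    simp [Φ, Fintype.linearCombination_apply, smul_monomial]
  refine ⟨Φ c, fun h => hc0 (funext fun i => ?_), ?_, fun p hp => ?_⟩
  · have := congrArg (coeff (i : σ →₀ ℕ)) h
    simpa [hΦ, coeff_sum, coeff_monomial] using this
  · rw [hΦ]
    refine IsHomogeneous.sum _ _ _ fun i _ => isHomogeneous_monomial _ ?_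
    have := i.2
    simp only [I, Finset.mem_finsuppAntidiag] at this
    rw [← this.1, Finsupp.degree_eq_sum]
  · have := congrFun (LinearMap.mem_ker.1 hc) ⟨p, hp⟩
    simpa [E, aeval_eq_eval] using this

end PolynomialsOnSubspaces

section NiceArrangements

open Module

/-- Basic numerics of a nice arrangement. -/
theorem Nice.isLine_and_card {D : ℕ} {C : Set (Submodule ℂ (Fin 4 → ℂ))} (hC : Nice D C) :
    1 ≤ D ∧ (∀ L ∈ C, IsLine L) ∧ C.Finite ∧ 2 * C.ncard + D = D * D := by
  induction hC with
  | base => simp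
  | step D Y Z H hY hZ hZD hZZ hZY hZm hH hYH hno ihY ihH =>
    obtain ⟨hD, hYl, hYf, hYc⟩ := ihY
    have hZf : Z.Finite := Set.finite_of_ncard_pos (by lia)
    refine ⟨by lia, ?_, hYf.union hZf, ?_⟩
    · rintro L (hL | hL)
      exacts [hYl L hL, hZ L hL]
    · rw [Set.ncard_union_eq (Set.disjoint_right.2 hZY) hYf hZf, hZD]
      nlinarith

/-- The lines of a nice arrangement impose enough conditions to kill all forms of low degree. -/
theorem Nice.eq_zero_of_totalDegree_add_two_le {D : ℕ} {C : Set (Submodule ℂ (Fin 4 → ℂ))}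
    (hC : Nice D C) : ∀ f : MvPolynomial (Fin 4) ℂ, f.totalDegree + 2 ≤ D →
      (∀ L ∈ C, ∀ x ∈ L, MvPolynomial.eval x f = 0) → f = 0 := by
  induction hC with
  | base => intro f hf; lia
  | step D Y Z H hY hZ hZD hZZ hZY hZm hH hYH hno ihY ihH =>
    intro f hfD hf
    obtain ⟨-, hl, hfin, hcard⟩ :=
      (Nice.step D Y Z H hY hZ hZD hZZ hZY hZm hH hYH hno).isLine_and_card
    obtain ⟨-, -, hfin', hcard'⟩ := hYH.isLine_and_card
    have hfinH : {L ∈ Y ∪ Z | L ≤ H}.Finite := hfin.subset (Set.sep_subset _ _)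
    have hcardH : {L ∈ Y ∪ Z | L ≤ H}.ncard = D := by
      have h : (Y ∪ Z).ncard = {L ∈ Y ∪ Z | L ≤ H}.ncard + {L ∈ Y ∪ Z | ¬ L ≤ H}.ncard := by
        rw [← Set.ncard_union_eq _ hfinH hfin']
        · congr 1
          ext L
          simp only [Set.mem_union, Set.mem_ofPred_eq]
          tauto
        · exact Set.disjoint_left.2 fun L h h' => h'.2 h.2
      nlinarith
    have hfH : ∀ x ∈ H, MvPolynomial.eval x f = 0 := by
      refine eval_eq_zero_of_totalDegree_lt_card hfinH.toFinset ?_ ?_ f ?_ ?_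
      · intro W hW
        exact (hfinH.mem_toFinset.1 hW).2
      · intro W hW
        rw [hl W (hfinH.mem_toFinset.1 hW).1, hH]
      · rw [← Set.ncard_eq_toFinset_card _ hfinH]
        lia
      · intro W hW
        exact hf W (hfinH.mem_toFinset.1 hW).1
    by_contra hf0
    have hHc : IsCoatom H := isCoatom_of_finrank_add_one_eq (by rw [hH]; simp)
    obtain ⟨g, hg0, hgd, hg⟩ := exists_totalDegree_lt_of_isCoatom hHc hf0 hfH
    exact hg0 (ihH g (by lia) fun L hL => hg L hL.2 (hf L hL.1))

/-- Vanishing on a nice arrangement is implied by vanishing at few points: a line of the layer of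
size `k` meets `k - 1` earlier lines, so `d + 2 - k` further points on it suffice. -/
theorem Nice.exists_finset_forall_eval_eq_zero {D : ℕ} {C : Set (Submodule ℂ (Fin 4 → ℂ))}
    (hC : Nice D C) (d : ℕ) :
    ∃ P : Finset (Fin 4 → ℂ), P.card ≤ ∑ k ∈ Finset.range D, k * (d + 2 - k) ∧
      ∀ f : MvPolynomial (Fin 4) ℂ, f.IsHomogeneous d → (∀ p ∈ P, MvPolynomial.eval p f = 0) →
        ∀ L ∈ C, ∀ x ∈ L, MvPolynomial.eval x f = 0 := by
  classical
  induction hC with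
  | base => exact ⟨∅, by simp, by simp⟩
  | step D Y Z H hY hZ hZD hZZ hZY hZm hH hYH hno ihY ihH =>
    obtain ⟨P, hP, hPf⟩ := ihY
    obtain ⟨hD, hYl, hYf, -⟩ := hY.isLine_and_card
    have hZf : Z.Finite := Set.finite_of_ncard_pos (by lia)
    have key : ∀ L ∈ Z, ∃ Q : Finset (Fin 4 → ℂ), Q.card ≤ d + 2 - D ∧
        ∀ f : MvPolynomial (Fin 4) ℂ, f.IsHomogeneous d →
          (∀ L' ∈ Y, ∀ x ∈ L', MvPolynomial.eval x f = 0) →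
          (∀ p ∈ Q, MvPolynomial.eval p f = 0) → ∀ x ∈ L, MvPolynomial.eval x f = 0 := by
      intro L hL
      have hLY : ∀ L' ∈ Y, L ≠ L' := fun L' hL' h => hZY L hL (h ▸ hL')
      have hMf : {L' ∈ Y | L ⊓ L' ≠ ⊥}.Finite := hYf.subset (Set.sep_subset _ _)
      have hinj : Set.InjOn (L ⊓ ·) {L' ∈ Y | L ⊓ L' ≠ ⊥} := by
        intro L₁ h₁ L₂ h₂ h
        by_contra hne
        refine h₁.2 ?_
        rw [← hno L (.inr hL) L₁ (.inl h₁.1) L₂ (.inl h₂.1) (hLY _ h₁.1) (hLY _ h₂.1) hne]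
        refine le_antisymm (le_inf le_rfl ?_) inf_le_left
        exact h.le.trans inf_le_right
      have hA : ∀ W ∈ hMf.toFinset.image (L ⊓ ·), W ≤ L ∧ finrank ℂ W = 1 := by
        intro W hW
        obtain ⟨L', hL', rfl⟩ := Finset.mem_image.1 hW
        obtain ⟨hL'Y, hne⟩ := hMf.mem_toFinset.1 hL'
        refine ⟨inf_le_left, le_antisymm ?_ (Submodule.one_le_finrank_iff.2 hne)⟩
        have hlt : L ⊓ L' < L := by
          refine lt_of_le_of_ne inf_le_left fun h => hLY L' hL'Y ?_
          exact Submodule.eq_of_le_of_finrank_eq (inf_eq_left.1 h)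
            ((hZ L hL).trans (hYl L' hL'Y).symm)
        have := Submodule.finrank_lt_finrank_of_lt hlt
        rw [hZ L hL] at this
        exact Nat.le_of_lt_succ this
      obtain ⟨Q, hQ, hQf⟩ := exists_finset_forall_eval_eq_zero_of_finrank_eq_two (hZ L hL) _ hA d
      refine ⟨Q, hQ.trans ?_, fun f hf hfY hfQ => hQf f hf ?_ hfQ⟩
      · rw [Finset.card_image_of_injOn (by simpa using hinj), ← Set.ncard_eq_toFinset_card _ hMf,
          hZm L hL]
        lia
      · intro W hW x hx
        obtain ⟨L', hL', rfl⟩ := Finset.mem_image.1 hW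
        exact hfY L' (hMf.mem_toFinset.1 hL').1 x hx.2
    choose! Q hQ hQf using key
    refine ⟨P ∪ hZf.toFinset.biUnion Q, ?_, fun f hf hfP => ?_⟩
    · rw [Finset.sum_range_succ]
      refine (Finset.card_union_le _ _).trans (add_le_add hP ?_)
      refine (Finset.card_biUnion_le_card_mul _ _ (d + 2 - D) fun L hL =>
        hQ L (hZf.mem_toFinset.1 hL)).trans_eq ?_
      rw [← Set.ncard_eq_toFinset_card _ hZf, hZD]
    · have hfY := hPf f hf fun p hp => hfP p (Finset.mem_union_left _ hp)
      rintro L (hL | hL)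
      · exact hfY L hL
      · refine hQf L hL f hf hfY fun p hp => hfP p (Finset.mem_union_right _ ?_)
        exact Finset.mem_biUnion.2 ⟨L, hZf.mem_toFinset.2 hL, hp⟩

theorem six_mul_sum_range_mul_sub (n c : ℕ) (h : n ≤ c) :
    6 * ∑ k ∈ Finset.range (n + 1), (k : ℤ) * ((c - k : ℕ) : ℤ) =
      n * (n + 1) * (3 * c - 2 * n - 1) := by
  induction n with
  | zero => simp
  | succ n ih =>
    rw [Finset.sum_range_succ, mul_add, ih (by lia), Nat.cast_sub h]
    push_cast
    ring

theorem sum_range_mul_sub_lt_choose (m : ℕ) :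
    ∑ k ∈ Finset.range (m + 1), k * (m + 2 - k) < (4 + m - 1).choose m := by
  have h1 := six_mul_sum_range_mul_sub m (m + 2) (by lia)
  have h2 : 6 * (4 + m - 1).choose m = (m + 3) * (m + 2) * (m + 1) := by
    have h := Nat.descFactorial_eq_factorial_mul_choose (m + 3) 3
    rw [show 4 + m - 1 = m + 3 by lia, Nat.choose_symm_add]
    simp [Nat.descFactorial, Nat.factorial] at h
    lia
  push_cast at h1
  zify at h2 ⊢
  nlinarith

end NiceArrangements

theorem stmt_10 (D : ℕ) (hD : 1 ≤ D) (Carr : Set (Submodule ℂ (Fin 4 → ℂ)))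
    (hC : Nice D Carr) :
    (∀ (d : ℕ) (f : MvPolynomial (Fin 4) ℂ), d + 2 ≤ D → f.IsHomogeneous d →
        (∀ L ∈ Carr, ∀ x ∈ L, MvPolynomial.eval x f = 0) → f = 0) ∧
    (∃ f : MvPolynomial (Fin 4) ℂ, f ≠ 0 ∧ f.IsHomogeneous (D - 1) ∧
        ∀ L ∈ Carr, ∀ x ∈ L, MvPolynomial.eval x f = 0) := by
  refine ⟨fun d f hd hf hfC => ?_, ?_⟩
  · have := hf.totalDegree_le
    exact hC.eq_zero_of_totalDegree_add_two_le f (by lia) hfC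
  · obtain ⟨m, rfl⟩ := Nat.exists_eq_add_of_le' hD
    obtain ⟨P, hP, hPf⟩ := hC.exists_finset_forall_eval_eq_zero m
    obtain ⟨f, hf0, hf, hfP⟩ := exists_isHomogeneous_ne_zero_of_card_lt m P
      (hP.trans_lt (by simpa using sum_range_mul_sub_lt_choose m))
    exact ⟨f, hf0, hf, hPf f hf hfP⟩
end

section
/- In the polynomial ring ℂ[X_{13}, X_{14}, X_{15}, X_{24}, X_{25}, X_{26}, X_{35}, X_{36}, X_{46}], the determinant of the 6×6 matrix M with rows (X_{13}, X_{25}, X_{24}, X_{15}, 0, X_{15}), (−X_{24}, X_{14} + X_{25}, X_{24}, X_{15}, 0, X_{15}), (−X_{25}, X_{25}, X_{24} + X_{35}, 0, X_{15}, X_{15}), (0, X_{25}, X_{24}, X_{15} + X_{26}, 0, X_{15}), (X_{25}, 0, 0, X_{25}, X_{36}, 0), (0, −X_{25}, 0, −X_{25}, X_{24}, X_{46}) equals Adj_3. -/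
open MvPolynomial

/- Variables `X_{13}, X_{14}, X_{15}, X_{24}, X_{25}, X_{26}, X_{35}, X_{36}, X_{46}`
of `ℂ[X_{13}, …, X_{46}]`, indexed by `Fin 9` in this order. -/
noncomputable def X13 : MvPolynomial (Fin 9) ℂ := X 0
noncomputable def X14 : MvPolynomial (Fin 9) ℂ := X 1
noncomputable def X15 : MvPolynomial (Fin 9) ℂ := X 2
noncomputable def X24 : MvPolynomial (Fin 9) ℂ := X 3
noncomputable def X25 : MvPolynomial (Fin 9) ℂ := X 4
noncomputable def X26 : MvPolynomial (Fin 9) ℂ := X 5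
noncomputable def X35 : MvPolynomial (Fin 9) ℂ := X 6
noncomputable def X36 : MvPolynomial (Fin 9) ℂ := X 7
noncomputable def X46 : MvPolynomial (Fin 9) ℂ := X 8

/-- The universal adjoint of the 3-dimensional ABHY associahedron. -/
noncomputable def Adj3 : MvPolynomial (Fin 9) ℂ :=
  X13*X14*X15*X24*X25*X35 + X14*X15*X24*X25*X26*X35 + X13*X14*X15*X25*X35*X36 +
  X13*X15*X25*X26*X35*X36 + X15*X24*X25*X26*X35*X36 + X13*X14*X15*X24*X25*X46 +
  X14*X15*X24*X25*X26*X46 + X13*X14*X15*X24*X36*X46 + X13*X14*X24*X26*X36*X46 +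
  X14*X24*X25*X26*X36*X46 + X13*X14*X15*X35*X36*X46 + X13*X14*X26*X35*X36*X46 +
  X13*X25*X26*X35*X36*X46 + X24*X25*X26*X35*X36*X46

/-- The AV-representation of `Adj3` from Example `ex:3dassoc`. -/
noncomputable def M11 : Matrix (Fin 6) (Fin 6) (MvPolynomial (Fin 9) ℂ) :=
  !![X13, X25, X24, X15, 0, X15;
     -X24, X14 + X25, X24, X15, 0, X15;
     -X25, X25, X24 + X35, 0, X15, X15;
     0, X25, X24, X15 + X26, 0, X15;
     X25, 0, 0, X25, X36, 0;
     0, -X25, 0, -X25, X24, X46]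

theorem stmt_11 : M11.det = Adj3 := by
  unfold M11 Adj3
  generalize X13 = a, X14 = b, X15 = c, X24 = d, X25 = e, X26 = f, X35 = g, X36 = h, X46 = k
  simp [Matrix.det_succ_row_zero, Fin.sum_univ_succ, Fin.succAbove]
  ring
end

section
/- In ℂ[X_{13}, X_{14}, X_{15}, X_{24}, X_{25}, X_{26}, X_{35}, X_{36}, X_{46}], the following Rayleigh-difference identity holds: (∂Adj_3/∂X_{13})·(∂Adj_3/∂X_{15}) − Adj_3·(∂²Adj_3/∂X_{13}∂X_{15}) = −X_{14}·X_{24}·X_{25}·X_{26}·X_{36}·X_{46}·G. -/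
open MvPolynomial

/-- The polynomial `G` from the proof of Lemma `lem:snake3d`. -/
noncomputable def G15 : MvPolynomial (Fin 9) ℂ :=
  X14*X24*X25*X35 - X14*X24*X26*X35 + X24*X25*X35^2 - X14*X26*X35^2 - X25*X26*X35^2 +
  X14*X25*X35*X36 - X24*X26*X35*X36 + X25*X26*X35*X36 + X25*X35^2*X36 - X26*X35^2*X36 +
  X14*X24*X25*X46 - X14*X24*X26*X46 + X24*X25*X35*X46 - X14*X26*X35*X46 -
  X25*X26*X35*X46 + X14*X24*X36*X46 + X14*X35*X36*X46 + X24*X35*X36*X46 +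
  X35^2*X36*X46

/- `X13` is the variable with index `0` and `X15` the variable with index `2`. -/
theorem stmt_15 :
    pderiv 0 Adj3 * pderiv 2 Adj3 - Adj3 * pderiv 0 (pderiv 2 Adj3) =
      -(X14 * X24 * X25 * X26 * X36 * X46) * G15 := by
  simp only [Adj3, G15, X13, X14, X15, X24, X25, X26, X35, X36, X46, map_add, Derivation.leibniz,
    smul_eq_mul, pderiv_X, Pi.single_apply, Fin.reduceEq, ite_true, ite_false, mul_zero, mul_one,
    zero_add, add_zero]
  ring
end

section
/- Let n ≥ 4 and consider the universal adjoint Adj_{n−2} of the (n+1)-gon. Then: (I) the iterated partial derivative of Adj_{n−2} with respect to all the variables X_{i,n+1} for 2 ≤ i ≤ n−1 (i.e., with respect to every diagonal of the (n+1)-gon containing the vertex n+1) equals Adj_{n−3}, the universal adjoint of the n-gon, regarded as an element of the polynomial ring of the (n+1)-gon via the inclusion of diagonals (every diagonal (i,j) of the n-gon, i.e., 1 ≤ i < j ≤ n, j − i ≥ 2, (i,j) ≠ (1,n), is also a diagonal of the (n+1)-gon); and (II) if Adj_{n−2} admits an AV-representation, then Adj_{n−3} admits an AV-representation. -/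
/-- `(i, j)` is a diagonal of the convex `m`-gon with vertices `1, …, m`:
`1 ≤ i < j ≤ m`, `j - i ≥ 2`, and `(i, j) ≠ (1, m)`. -/
def IsDiag (m : ℕ) (p : ℕ × ℕ) : Prop :=
  1 ≤ p.1 ∧ p.1 + 2 ≤ p.2 ∧ p.2 ≤ m ∧ ¬(p.1 = 1 ∧ p.2 = m)

/-- Two diagonals `(i,j)` and `(k,l)` cross if `i < k < j < l` or `k < i < l < j`. -/
def Crossing (p q : ℕ × ℕ) : Prop :=
  (p.1 < q.1 ∧ q.1 < p.2 ∧ p.2 < q.2) ∨ (q.1 < p.1 ∧ p.1 < q.2 ∧ q.2 < p.2)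

open scoped Classical in
/-- The finite set of diagonals of the `m`-gon. -/
noncomputable def diagonals (m : ℕ) : Finset (ℕ × ℕ) :=
  (Finset.range (m + 1) ×ˢ Finset.range (m + 1)).filter (IsDiag m)

/-- A triangulation of the `m`-gon: a set of `m - 3` pairwise non-crossing diagonals. -/
def IsTriangulation (m : ℕ) (T : Finset (ℕ × ℕ)) : Prop :=
  T.card = m - 3 ∧ (∀ p ∈ T, IsDiag m p) ∧ ∀ p ∈ T, ∀ q ∈ T, ¬ Crossing p q

open scoped Classical in
/-- The finite set of all triangulations of the `m`-gon. -/
noncomputable def triangulations (m : ℕ) : Finset (Finset (ℕ × ℕ)) :=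
  (diagonals m).powerset.filter (IsTriangulation m)

/-- The universal adjoint `Adj_{m-3} = Σ_T Π_{(i,j) ∉ T} X_{ij}` of the
`(m-3)`-dimensional ABHY associahedron, as an element of the polynomial ring over `ℂ`
with one variable `X (i, j)` for each pair `(i, j)`; only the variables indexed by
diagonals of the `m`-gon occur, and polynomial rings on fewer vertices are included in
those on more vertices via the inclusion of diagonals. -/
noncomputable def Adj (m : ℕ) : MvPolynomial (ℕ × ℕ) ℂ :=
  ∑ T ∈ triangulations m, ∏ d ∈ diagonals m \ T, MvPolynomial.X d

/-- `Adj_{m-3}` admits an AV-representation: there are a triangulation `T` of the `m`-gon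
and a square matrix `A`, indexed by the diagonals of the `m`-gon not in `T`, with entries
in `ℂ[X_{ij} : (i,j) ∈ T]`, such that `Adj_{m-3} = det(diag(X_{ij} : (i,j) ∉ T) + A)`. -/
def HasAVRep (m : ℕ) : Prop :=
  ∃ T : Finset (ℕ × ℕ), IsTriangulation m T ∧
    ∃ A : Matrix {d // d ∈ diagonals m \ T} {d // d ∈ diagonals m \ T}
        (MvPolynomial (ℕ × ℕ) ℂ),
      (∀ i j, A i j ∈ MvPolynomial.supported ℂ (↑T : Set (ℕ × ℕ))) ∧
      Adj m = (Matrix.diagonal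
          (fun d : {d // d ∈ diagonals m \ T} => MvPolynomial.X d.val) + A).det

/-- Iterated formal partial derivative with respect to a list of variables. -/
noncomputable def iterPDeriv (l : List (ℕ × ℕ)) (p : MvPolynomial (ℕ × ℕ) ℂ) :
    MvPolynomial (ℕ × ℕ) ℂ :=
  l.foldr (fun d q => MvPolynomial.pderiv d q) p

/-- The diagonals of the `(n+1)`-gon containing the vertex `n+1`, namely
`(i, n+1)` for `2 ≤ i ≤ n-1`, as a list. -/
def vertexDiags (n : ℕ) : List (ℕ × ℕ) :=
  (List.range (n - 2)).map (fun t => (t + 2, n + 1))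

/-- A set of pairwise non-crossing diagonals of the `m`-gon. -/
def IsNoncrossing (m : ℕ) (T : Finset (ℕ × ℕ)) : Prop :=
  (∀ p ∈ T, IsDiag m p) ∧ ∀ p ∈ T, ∀ q ∈ T, ¬ Crossing p q

theorem IsTriangulation.isNoncrossing {m : ℕ} {T : Finset (ℕ × ℕ)} (h : IsTriangulation m T) :
    IsNoncrossing m T := h.2

theorem mem_diagonals {m : ℕ} {p : ℕ × ℕ} : p ∈ diagonals m ↔ IsDiag m p := by
  simp only [diagonals, Finset.mem_filter, Finset.mem_product, Finset.mem_range, IsDiag]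
  omega

theorem mem_triangulations {m : ℕ} {T : Finset (ℕ × ℕ)} :
    T ∈ triangulations m ↔ IsTriangulation m T := by
  simp only [triangulations, Finset.mem_filter, Finset.mem_powerset, and_iff_right_iff_imp]
  exact fun h p hp => mem_diagonals.2 (h.2.1 p hp)

/-! ### Rotation of the polygon -/

/-- The action on diagonals of the rotation `i ↦ i + 1`, `m ↦ 1` of the `m`-gon. -/
def rotate (m : ℕ) (p : ℕ × ℕ) : ℕ × ℕ :=
  if p.2 = m then (1, p.1 + 1) else (p.1 + 1, p.2 + 1)

theorem IsDiag.rotate {m : ℕ} {p : ℕ × ℕ} (h : IsDiag m p) : IsDiag m (rotate m p) := by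
  unfold IsDiag at *
  unfold _root_.rotate
  split_ifs <;> dsimp only <;> omega

theorem rotate_injOn (m : ℕ) : Set.InjOn (rotate m) {p | IsDiag m p} := by
  rintro ⟨a, b⟩ hp ⟨c, d⟩ hq h
  simp only [Set.mem_ofPred_eq, IsDiag] at hp hq
  unfold rotate at h
  dsimp only at h
  split_ifs at h <;> simp only [Prod.mk.injEq] at h ⊢ <;> omega

theorem Crossing.of_rotate {m : ℕ} {p q : ℕ × ℕ} (hp : IsDiag m p) (hq : IsDiag m q)
    (h : Crossing (rotate m p) (rotate m q)) : Crossing p q := by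
  unfold IsDiag at hp hq
  unfold Crossing rotate at *
  split_ifs at h <;> dsimp only at h <;> omega

theorem IsNoncrossing.rotate {m : ℕ} {T : Finset (ℕ × ℕ)} (h : IsNoncrossing m T) :
    IsNoncrossing m (T.image (rotate m)) := by
  simp only [IsNoncrossing, Finset.forall_mem_image]
  exact ⟨fun p hp => (h.1 p hp).rotate,
    fun p hp q hq hc => h.2 p hp q hq (hc.of_rotate (h.1 p hp) (h.1 q hq))⟩

theorem IsNoncrossing.card_rotate {m : ℕ} {T : Finset (ℕ × ℕ)} (h : IsNoncrossing m T) :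
    (T.image (_root_.rotate m)).card = T.card :=
  Finset.card_image_of_injOn ((rotate_injOn m).mono fun p hp => h.1 p hp)

theorem IsTriangulation.rotate {m : ℕ} {T : Finset (ℕ × ℕ)} (h : IsTriangulation m T) :
    IsTriangulation m (T.image (rotate m)) :=
  ⟨h.isNoncrossing.card_rotate.trans h.1, h.isNoncrossing.rotate⟩

theorem image_rotate_diagonals (m : ℕ) : (diagonals m).image (rotate m) = diagonals m := by
  refine Finset.eq_of_subset_of_card_le ?_ ?_
  · simp only [Finset.image_subset_iff, mem_diagonals]
    exact fun p hp => hp.rotate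
  · rw [Finset.card_image_of_injOn ((rotate_injOn m).mono fun p hp => mem_diagonals.1 hp)]

theorem image_rotate_sdiff {m : ℕ} {T : Finset (ℕ × ℕ)} (h : IsNoncrossing m T) :
    (diagonals m \ T).image (rotate m) = diagonals m \ T.image (rotate m) := by
  rw [Finset.image_sdiff_of_injOn _ (fun p hp => mem_diagonals.2 (h.1 p hp)),
    image_rotate_diagonals]
  exact (rotate_injOn m).mono fun p hp => mem_diagonals.1 hp

/-! ### Ears -/

/-- A nonempty non-crossing set of diagonals leaves some vertex uncovered. -/
theorem IsNoncrossing.exists_ear {m : ℕ} {T : Finset (ℕ × ℕ)} (h : IsNoncrossing m T)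
    (hT : T.Nonempty) : ∃ v, 1 ≤ v ∧ v ≤ m ∧ ∀ p ∈ T, p.1 ≠ v ∧ p.2 ≠ v := by
  obtain ⟨d, hd, hmin⟩ := T.exists_min_image (fun p => p.2 - p.1) hT
  have h1 := h.1 d hd
  unfold IsDiag at h1
  refine ⟨d.1 + 1, by omega, by omega, fun p hp => ?_⟩
  have h2 := h.1 p hp
  have h3 := h.2 d hd p hp
  have h4 := hmin p hp
  unfold IsDiag at h2
  unfold Crossing at h3
  omega

theorem IsNoncrossing.exists_ear_last {m : ℕ} {P : Finset (ℕ × ℕ) → Prop}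
    (hP : ∀ T, IsNoncrossing m T → P T → P (T.image (_root_.rotate m)))
    {T : Finset (ℕ × ℕ)} (h : IsNoncrossing m T) (hT : T.Nonempty) (hPT : P T) :
    ∃ T', IsNoncrossing m T' ∧ (∀ p ∈ T', p.2 ≠ m) ∧ P T' := by
  obtain ⟨v, hv, hvm, hear⟩ := h.exists_ear hT
  clear hT
  obtain ⟨k, hk⟩ := Nat.exists_eq_add_of_le hvm
  clear hvm
  induction k generalizing T v with
  | zero => exact ⟨T, h, fun p hp => hk ▸ (hear p hp).2, hPT⟩
  | succ k ih =>
    refine ih h.rotate (hP T h hPT) (v + 1) (by omega) ?_ (by omega)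
    simp only [Finset.forall_mem_image]
    intro p hp
    have h1 := hear p hp
    have h2 := h.1 p hp
    unfold IsDiag at h2
    unfold _root_.rotate
    split_ifs <;> dsimp only <;> omega

theorem IsNoncrossing.of_succ {m : ℕ} {T : Finset (ℕ × ℕ)} (h : IsNoncrossing (m + 1) T)
    (hear : ∀ p ∈ T, p.2 ≠ m + 1) : IsNoncrossing m (T.erase (1, m)) := by
  refine ⟨fun p hp => ?_, fun p hp q hq => h.2 p (Finset.mem_of_mem_erase hp) q
    (Finset.mem_of_mem_erase hq)⟩
  rw [Finset.mem_erase, ne_eq, Prod.ext_iff] at hp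
  have h1 := h.1 p hp.2
  have h2 := hear p hp.2
  unfold IsDiag at *
  dsimp only at hp
  omega

theorem IsNoncrossing.card_le {m : ℕ} (hm : 3 ≤ m) {T : Finset (ℕ × ℕ)}
    (h : IsNoncrossing m T) : T.card ≤ m - 3 := by
  induction m, hm using Nat.le_induction generalizing T with
  | base =>
    rw [Nat.sub_self, Nat.le_zero, Finset.card_eq_zero, Finset.eq_empty_iff_forall_notMem]
    intro p hp
    have := h.1 p hp
    unfold IsDiag at this
    omega
  | succ m hm ih =>
    rcases T.eq_empty_or_nonempty with rfl | hT
    · simp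
    obtain ⟨T', h', hear, hc⟩ := h.exists_ear_last (P := fun T' => T'.card = T.card)
      (fun S hS hc => hS.card_rotate.trans hc) hT rfl
    have h1 := ih (h'.of_succ hear)
    have h2 := T'.pred_card_le_card_erase (a := (1, m))
    omega

theorem IsTriangulation.mem_of_ear_last {n : ℕ} (hn : 3 ≤ n) {T : Finset (ℕ × ℕ)}
    (h : IsTriangulation (n + 1) T) (hear : ∀ p ∈ T, p.2 ≠ n + 1) : (1, n) ∈ T := by
  by_contra hmem
  have h1 := (h.isNoncrossing.of_succ hear).card_le hn
  rw [Finset.erase_eq_of_notMem hmem, h.1] at h1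
  omega

theorem IsTriangulation.erase_of_ear_last {n : ℕ} (hn : 3 ≤ n) {T : Finset (ℕ × ℕ)}
    (h : IsTriangulation (n + 1) T) (hear : ∀ p ∈ T, p.2 ≠ n + 1) :
    IsTriangulation n (T.erase (1, n)) := by
  refine ⟨?_, h.isNoncrossing.of_succ hear⟩
  rw [Finset.card_erase_of_mem (h.mem_of_ear_last hn hear), h.1]
  omega

theorem IsTriangulation.insert_ear {n : ℕ} (hn : 3 ≤ n) {T : Finset (ℕ × ℕ)}
    (h : IsTriangulation n T) : IsTriangulation (n + 1) (insert (1, n) T) := by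
  refine ⟨?_, ?_, ?_⟩
  · rw [Finset.card_insert_of_notMem fun hmem => (h.2.1 _ hmem).2.2.2 ⟨rfl, rfl⟩, h.1]
    omega
  · intro p hp
    rcases Finset.mem_insert.1 hp with rfl | hp
    · unfold IsDiag; dsimp only; omega
    · have := h.2.1 p hp
      unfold IsDiag at *
      omega
  · have key : ∀ p ∈ T, ¬ Crossing (1, n) p ∧ ¬ Crossing p (1, n) := by
      intro p hp
      have := h.2.1 p hp
      unfold IsDiag at this
      unfold Crossing
      dsimp only
      omega
    intro p hp q hq
    rcases Finset.mem_insert.1 hp with rfl | hp <;> rcases Finset.mem_insert.1 hq with rfl | hq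
    · unfold Crossing; omega
    · exact (key q hq).1
    · exact (key p hp).2
    · exact h.2.2 p hp q hq

/-! ### Iterated derivatives of the adjoint -/

theorem mem_vertexDiags {n : ℕ} {p : ℕ × ℕ} :
    p ∈ vertexDiags n ↔ IsDiag (n + 1) p ∧ p.2 = n + 1 := by
  obtain ⟨a, b⟩ := p
  simp only [vertexDiags, List.mem_map, List.mem_range, Prod.mk.injEq, IsDiag]
  constructor
  · rintro ⟨t, ht, rfl, rfl⟩
    omega
  · intro h
    exact ⟨a - 2, by omega, by omega, by omega⟩

theorem nodup_vertexDiags (n : ℕ) : (vertexDiags n).Nodup :=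
  List.nodup_range.map fun a b h => by simpa using h

theorem iterPDeriv_sum {ι : Type*} (l : List (ℕ × ℕ)) (s : Finset ι)
    (f : ι → MvPolynomial (ℕ × ℕ) ℂ) :
    iterPDeriv l (∑ i ∈ s, f i) = ∑ i ∈ s, iterPDeriv l (f i) := by
  induction l with
  | nil => rfl
  | cons d l ih =>
    simp only [iterPDeriv, List.foldr_cons] at *
    rw [ih, map_sum]

theorem pderiv_eq_zero_of_mem_supported {s : Set (ℕ × ℕ)} {d : ℕ × ℕ} (hd : d ∉ s)
    {p : MvPolynomial (ℕ × ℕ) ℂ} (hp : p ∈ MvPolynomial.supported ℂ s) :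
    MvPolynomial.pderiv d p = 0 :=
  MvPolynomial.pderiv_eq_zero_of_notMem_vars fun h => hd (MvPolynomial.mem_supported.1 hp h)

theorem prod_X_mem_supported (S : Finset (ℕ × ℕ)) :
    (∏ e ∈ S, MvPolynomial.X e : MvPolynomial (ℕ × ℕ) ℂ) ∈
      MvPolynomial.supported ℂ (↑S : Set (ℕ × ℕ)) :=
  Subalgebra.prod_mem _ fun _ he => MvPolynomial.X_mem_supported.2 he

theorem pderiv_prod_X (S : Finset (ℕ × ℕ)) (d : ℕ × ℕ) :
    MvPolynomial.pderiv d (∏ e ∈ S, MvPolynomial.X e : MvPolynomial (ℕ × ℕ) ℂ) =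
      if d ∈ S then ∏ e ∈ S.erase d, MvPolynomial.X e else 0 := by
  split_ifs with h
  · rw [← Finset.mul_prod_erase S _ h, Derivation.leibniz, MvPolynomial.pderiv_X_self,
      pderiv_eq_zero_of_mem_supported (by simp) (prod_X_mem_supported (S.erase d))]
    simp
  · exact pderiv_eq_zero_of_mem_supported (by simpa using h) (prod_X_mem_supported S)

theorem iterPDeriv_prod_X {l : List (ℕ × ℕ)} (hl : l.Nodup) (S : Finset (ℕ × ℕ)) :
    iterPDeriv l (∏ e ∈ S, MvPolynomial.X e) =
      if l.toFinset ⊆ S then ∏ e ∈ S \ l.toFinset, MvPolynomial.X e else 0 := by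
  induction l with
  | nil => simp [iterPDeriv]
  | cons d l ih =>
    rw [List.nodup_cons] at hl
    have ih := ih hl.2
    simp only [iterPDeriv, List.foldr_cons] at ih ⊢
    simp only [ih, List.toFinset_cons, Finset.insert_subset_iff]
    by_cases h : l.toFinset ⊆ S
    · rw [if_pos h, pderiv_prod_X, Finset.sdiff_insert]
      simp [h, hl.1]
    · simp [h]

theorem diagonals_succ_sdiff {n : ℕ} (hn : 3 ≤ n) {T : Finset (ℕ × ℕ)} (hT : (1, n) ∈ T) :
    (diagonals (n + 1) \ T) \ (vertexDiags n).toFinset = diagonals n \ T.erase (1, n) := by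
  ext p
  by_cases hp : p = (1, n)
  · subst hp
    simp [hT, mem_diagonals, IsDiag]
  · simp only [Finset.mem_sdiff, Finset.mem_erase, mem_diagonals, List.mem_toFinset,
      mem_vertexDiags, hp, ne_eq, not_false_eq_true, true_and]
    rw [Prod.ext_iff] at hp
    unfold IsDiag
    dsimp only at hp
    by_cases hpT : p ∈ T
    · simp only [hpT, not_true_eq_false, and_false, false_and]
    · simp only [hpT, not_false_eq_true, and_true]
      omega

theorem vertexDiags_subset_iff {n : ℕ} {T : Finset (ℕ × ℕ)} (hT : IsTriangulation (n + 1) T) :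
    (vertexDiags n).toFinset ⊆ diagonals (n + 1) \ T ↔ ∀ p ∈ T, p.2 ≠ n + 1 := by
  simp only [Finset.subset_iff, List.mem_toFinset, mem_vertexDiags, Finset.mem_sdiff,
    mem_diagonals]
  exact ⟨fun h p hp h2 => (h ⟨hT.2.1 p hp, h2⟩).2 hp,
    fun h p hp => ⟨hp.1, fun hpT => h p hpT hp.2⟩⟩

theorem iterPDeriv_Adj {n : ℕ} (hn : 3 ≤ n) :
    iterPDeriv (vertexDiags n) (Adj (n + 1)) = Adj n := by
  classical
  unfold Adj
  simp only [iterPDeriv_sum, iterPDeriv_prod_X (nodup_vertexDiags n)]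
  rw [← Finset.sum_filter]
  have hmem : ∀ T, T ∈ (triangulations (n + 1)).filter
      (fun T => (vertexDiags n).toFinset ⊆ diagonals (n + 1) \ T) ↔
      IsTriangulation (n + 1) T ∧ ∀ p ∈ T, p.2 ≠ n + 1 := by
    intro T
    rw [Finset.mem_filter, mem_triangulations]
    exact and_congr_right vertexDiags_subset_iff
  have hnot : ∀ T, IsTriangulation n T → (1, n) ∉ T :=
    fun T hT hmem => (hT.2.1 _ hmem).2.2.2 ⟨rfl, rfl⟩
  refine Finset.sum_bij' (fun T _ => T.erase (1, n)) (fun T _ => insert (1, n) T) ?_ ?_ ?_ ?_ ?_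
  · intro T hT
    rw [hmem] at hT
    exact mem_triangulations.2 (hT.1.erase_of_ear_last hn hT.2)
  · intro T hT
    rw [mem_triangulations] at hT
    rw [hmem]
    refine ⟨hT.insert_ear hn, fun p hp => ?_⟩
    rcases Finset.mem_insert.1 hp with rfl | hp
    · simp
    · have := hT.2.1 p hp
      unfold IsDiag at this
      omega
  · intro T hT
    rw [hmem] at hT
    exact Finset.insert_erase (hT.1.mem_of_ear_last hn hT.2)
  · intro T hT
    exact Finset.erase_insert (hnot T (mem_triangulations.1 hT))
  · intro T hT
    rw [hmem] at hT
    rw [diagonals_succ_sdiff hn (hT.1.mem_of_ear_last hn hT.2)]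

/-! ### Determinantal representations -/

/-- `Adj m` admits an AV-representation with respect to the triangulation `T`. -/
def HasAVRepAt (m : ℕ) (T : Finset (ℕ × ℕ)) : Prop :=
  IsTriangulation m T ∧
    ∃ A : Matrix {d // d ∈ diagonals m \ T} {d // d ∈ diagonals m \ T}
        (MvPolynomial (ℕ × ℕ) ℂ),
      (∀ i j, A i j ∈ MvPolynomial.supported ℂ (↑T : Set (ℕ × ℕ))) ∧
      Adj m = (Matrix.diagonal
          (fun d : {d // d ∈ diagonals m \ T} => MvPolynomial.X d.val) + A).det

theorem HasAVRepAt.of_equiv {m : ℕ} {T : Finset (ℕ × ℕ)} (hT : IsTriangulation m T)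
    {ι : Type*} [Fintype ι] [DecidableEq ι] (e : ι ≃ {d // d ∈ diagonals m \ T})
    (A : Matrix ι ι (MvPolynomial (ℕ × ℕ) ℂ))
    (hA : ∀ i j, A i j ∈ MvPolynomial.supported ℂ (↑T : Set (ℕ × ℕ)))
    (h : Adj m = (Matrix.diagonal (fun i => MvPolynomial.X (e i).val) + A).det) :
    HasAVRepAt m T := by
  refine ⟨hT, A.submatrix e.symm e.symm, fun i j => hA _ _, ?_⟩
  rw [h, ← Matrix.det_submatrix_equiv_self e.symm, Matrix.submatrix_add, Pi.add_apply,
    Pi.add_apply, Matrix.submatrix_diagonal_equiv]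
  simp [Function.comp_def]

theorem map_det_diagonal_add {ι : Type*} [Fintype ι] [DecidableEq ι]
    (f : MvPolynomial (ℕ × ℕ) ℂ →ₐ[ℂ] MvPolynomial (ℕ × ℕ) ℂ)
    (v : ι → MvPolynomial (ℕ × ℕ) ℂ) (A : Matrix ι ι (MvPolynomial (ℕ × ℕ) ℂ)) :
    f (Matrix.diagonal v + A).det = (Matrix.diagonal (fun i => f (v i)) + A.map f).det := by
  rw [AlgHom.map_det, AlgHom.mapMatrix_apply, Matrix.map_add _ (map_add f),
    Matrix.diagonal_map (map_zero f)]

theorem rename_rotate_Adj (m : ℕ) : MvPolynomial.rename (rotate m) (Adj m) = Adj m := by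
  classical
  have hinj : Set.InjOn (fun T : Finset (ℕ × ℕ) => T.image (rotate m)) ↑(triangulations m) := by
    intro S hS T hT h
    rw [Finset.mem_coe, mem_triangulations] at hS hT
    refine Finset.coe_injective ?_
    refine ((rotate_injOn m).image_eq_image_iff (fun p hp => hS.2.1 p hp)
      (fun p hp => hT.2.1 p hp)).1 ?_
    simpa using congrArg (fun U : Finset (ℕ × ℕ) => (U : Set (ℕ × ℕ))) h
  have hmaps : Set.MapsTo (fun T : Finset (ℕ × ℕ) => T.image (rotate m))
      ↑(triangulations m) ↑(triangulations m) := by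
    intro T hT
    rw [Finset.mem_coe, mem_triangulations] at *
    exact hT.rotate
  unfold Adj
  rw [map_sum]
  refine Finset.sum_nbij (fun T => T.image (rotate m)) hmaps hinj
    (Finset.surjOn_of_injOn_of_card_le _ hmaps hinj le_rfl) ?_
  intro T hT
  rw [mem_triangulations] at hT
  rw [map_prod, ← image_rotate_sdiff hT.isNoncrossing, Finset.prod_image]
  · simp
  · exact (rotate_injOn m).mono fun p hp => mem_diagonals.1 (Finset.mem_sdiff.1 hp).1

theorem HasAVRepAt.rotate {m : ℕ} {T : Finset (ℕ × ℕ)} (h : HasAVRepAt m T) :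
    HasAVRepAt m (T.image (rotate m)) := by
  classical
  obtain ⟨hT, A, hA, hdet⟩ := h
  let g : {d // d ∈ diagonals m \ T} → {d // d ∈ diagonals m \ T.image (_root_.rotate m)} :=
    fun d => ⟨_root_.rotate m d, by
      rw [← image_rotate_sdiff hT.isNoncrossing]
      exact Finset.mem_image_of_mem _ d.2⟩
  have hg : Function.Bijective g := by
    constructor
    · intro a b hab
      exact Subtype.ext (rotate_injOn m (mem_diagonals.1 (Finset.mem_sdiff.1 a.2).1)
        (mem_diagonals.1 (Finset.mem_sdiff.1 b.2).1) (congrArg Subtype.val hab))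
    · rintro ⟨b, hb⟩
      rw [← image_rotate_sdiff hT.isNoncrossing] at hb
      obtain ⟨a, ha, rfl⟩ := Finset.mem_image.1 hb
      exact ⟨⟨a, ha⟩, rfl⟩
  refine HasAVRepAt.of_equiv hT.rotate (Equiv.ofBijective g hg)
    (A.map (MvPolynomial.rename (_root_.rotate m))) (fun i j => ?_) ?_
  · have := hA i j
    rw [MvPolynomial.mem_supported] at this ⊢
    refine (Finset.coe_subset.2 (MvPolynomial.vars_rename _ _)).trans ?_
    rw [Finset.coe_image, Finset.coe_image]
    exact Set.image_mono this
  · rw [← rename_rotate_Adj, hdet, map_det_diagonal_add]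
    simp [g]

section PrincipalMinor

variable {ι : Type*} [Fintype ι] [DecidableEq ι]

theorem det_mem_of_forall_mem (S : Subalgebra ℂ (MvPolynomial (ℕ × ℕ) ℂ))
    {M : Matrix ι ι (MvPolynomial (ℕ × ℕ) ℂ)} (h : ∀ i j, M i j ∈ S) : M.det ∈ S := by
  rw [Matrix.det_apply]
  exact S.sum_mem fun σ _ => zsmul_mem (S.prod_mem fun i _ => h _ _) _

/-- The matrix `diag(X) + A` with the rows labelled by `W` replaced by unit vectors. -/
noncomputable def unitRows (v : ι → ℕ × ℕ) (A : Matrix ι ι (MvPolynomial (ℕ × ℕ) ℂ))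
    (W : Finset (ℕ × ℕ)) : Matrix ι ι (MvPolynomial (ℕ × ℕ) ℂ) :=
  fun i => if v i ∈ W then Pi.single i 1 else Pi.single i (MvPolynomial.X (v i)) + A i

theorem pderiv_det_unitRows {v : ι → ℕ × ℕ} (hv : Function.Injective v)
    {A : Matrix ι ι (MvPolynomial (ℕ × ℕ) ℂ)} {s : Set (ℕ × ℕ)}
    (hA : ∀ i j, A i j ∈ MvPolynomial.supported ℂ s) {W : Finset (ℕ × ℕ)} {k : ι}
    (hs : v k ∉ s) (hW : v k ∉ W) :
    MvPolynomial.pderiv (v k) (unitRows v A W).det = (unitRows v A (insert (v k) W)).det := by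
  have hA' : ∀ i j, A i j ∈ MvPolynomial.supported ℂ {v k}ᶜ := fun i j =>
    MvPolynomial.supported_mono (Set.subset_compl_singleton_iff.2 hs) (hA i j)
  have hrow : ∀ i j, i ≠ k → unitRows v A W i j ∈ MvPolynomial.supported ℂ {v k}ᶜ := by
    intro i j hi
    unfold unitRows
    split_ifs
    · rw [Pi.single_apply]
      split_ifs
      exacts [one_mem _, zero_mem _]
    · rw [Pi.add_apply, Pi.single_apply]
      refine add_mem ?_ (hA' i j)
      split_ifs
      · exact MvPolynomial.X_mem_supported.2 fun h => hi (hv h)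
      · exact zero_mem _
  have hdet : ∀ r : ι → MvPolynomial (ℕ × ℕ) ℂ,
      (∀ j, r j ∈ MvPolynomial.supported ℂ {v k}ᶜ) →
      MvPolynomial.pderiv (v k) ((unitRows v A W).updateRow k r).det = 0 := by
    intro r hr
    refine pderiv_eq_zero_of_mem_supported (s := {v k}ᶜ) (by simp)
      (det_mem_of_forall_mem _ fun i j => ?_)
    rw [Matrix.updateRow_apply]
    split_ifs with h
    exacts [hr j, hrow i j h]
  have hunit : unitRows v A (insert (v k) W) =
      (unitRows v A W).updateRow k (Pi.single k 1) := by
    ext1 i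
    by_cases hi : i = k
    · subst hi
      simp [unitRows]
    · rw [Matrix.updateRow_ne hi]
      simp [unitRows, hv.ne hi]
  have hk : unitRows v A W k =
      (MvPolynomial.X (v k) : MvPolynomial (ℕ × ℕ) ℂ) • Pi.single k 1 + A k := by
    rw [← Pi.single_smul]
    simp [unitRows, hW]
  rw [hunit]
  conv_lhs => rw [← Matrix.updateRow_eq_self (unitRows v A W) k]
  rw [hk, Matrix.det_updateRow_add, Matrix.det_updateRow_smul, map_add, hdet _ (hA' k),
    Derivation.leibniz, MvPolynomial.pderiv_X_self, hdet]
  · simp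
  · intro j
    rw [Pi.single_apply]
    split_ifs
    exacts [one_mem _, zero_mem _]

theorem iterPDeriv_det {v : ι → ℕ × ℕ} (hv : Function.Injective v)
    {A : Matrix ι ι (MvPolynomial (ℕ × ℕ) ℂ)} {s : Set (ℕ × ℕ)}
    (hA : ∀ i j, A i j ∈ MvPolynomial.supported ℂ s) {l : List (ℕ × ℕ)} (hl : l.Nodup)
    (hls : ∀ d ∈ l, d ∉ s) (hlv : ∀ d ∈ l, d ∈ Set.range v) :
    iterPDeriv l (Matrix.diagonal (fun i => MvPolynomial.X (v i)) + A).det =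
      (unitRows v A l.toFinset).det := by
  induction l with
  | nil =>
    refine congrArg Matrix.det ?_
    ext1 i j
    simp [unitRows, Matrix.diagonal_apply, Pi.single_apply, eq_comm]
  | cons d l ih =>
    rw [List.nodup_cons] at hl
    have ih := ih hl.2 (fun d hd => hls d (List.mem_cons_of_mem _ hd))
      (fun d hd => hlv d (List.mem_cons_of_mem _ hd))
    obtain ⟨k, rfl⟩ := hlv d List.mem_cons_self
    simp only [iterPDeriv, List.foldr_cons] at ih ⊢
    rw [ih, List.toFinset_cons]
    exact pderiv_det_unitRows hv hA (hls _ List.mem_cons_self) (by simpa using hl.1)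

theorem det_unitRows (v : ι → ℕ × ℕ) (A : Matrix ι ι (MvPolynomial (ℕ × ℕ) ℂ))
    (W : Finset (ℕ × ℕ)) :
    (unitRows v A W).det =
      (Matrix.diagonal (fun i : {i // v i ∉ W} => MvPolynomial.X (v i)) +
        A.submatrix Subtype.val Subtype.val).det := by
  rw [Matrix.twoBlockTriangular_det' _ (fun i => v i ∈ W)]
  · have h1 : (unitRows v A W).toSquareBlockProp (fun i => v i ∈ W) = 1 := by
      ext i j
      simp [Matrix.toSquareBlockProp_def, unitRows, i.2, Matrix.one_apply, Pi.single_apply,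
        Subtype.ext_iff, eq_comm]
    rw [h1, Matrix.det_one, one_mul]
    refine congrArg Matrix.det ?_
    ext1 i j
    simp [Matrix.toSquareBlockProp_def, unitRows, i.2, Matrix.diagonal_apply, Pi.single_apply,
      Subtype.ext_iff, eq_comm]
  · intro i hi j hj
    have : j ≠ i := fun h => hj (h ▸ hi)
    simp [unitRows, hi, this]

end PrincipalMinor

theorem HasAVRepAt.of_ear_last {n : ℕ} (hn : 3 ≤ n) {T : Finset (ℕ × ℕ)}
    (h : HasAVRepAt (n + 1) T) (hear : ∀ p ∈ T, p.2 ≠ n + 1) :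
    HasAVRepAt n (T.erase (1, n)) := by
  classical
  obtain ⟨hT, A, hA, hdet⟩ := h
  have h1n := hT.mem_of_ear_last hn hear
  have hD := diagonals_succ_sdiff hn h1n
  let f : MvPolynomial (ℕ × ℕ) ℂ →ₐ[ℂ] MvPolynomial (ℕ × ℕ) ℂ :=
    MvPolynomial.aeval fun d => if d = (1, n) then 0 else MvPolynomial.X d
  have hfX : ∀ d, d ∈ diagonals n → f (MvPolynomial.X d) = MvPolynomial.X d := by
    intro d hd
    have : d ≠ (1, n) := by
      rintro rfl
      exact (mem_diagonals.1 hd).2.2.2 ⟨rfl, rfl⟩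
    simp [f, this]
  have hfAdj : f (Adj n) = Adj n := by
    unfold Adj
    simp only [map_sum, map_prod]
    exact Finset.sum_congr rfl fun S _ => Finset.prod_congr rfl fun d hd =>
      hfX d (Finset.mem_sdiff.1 hd).1
  have hfsupp : ∀ p ∈ MvPolynomial.supported ℂ (↑T : Set (ℕ × ℕ)),
      f p ∈ MvPolynomial.supported ℂ (↑(T.erase (1, n)) : Set (ℕ × ℕ)) := by
    intro p hp
    have hle : MvPolynomial.supported ℂ (↑T : Set (ℕ × ℕ)) ≤
        (MvPolynomial.supported ℂ (↑(T.erase (1, n)) : Set (ℕ × ℕ))).comap f := by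
      refine Algebra.adjoin_le ?_
      rintro _ ⟨d, hd, rfl⟩
      by_cases h : d = (1, n)
      · simp [f, h]
      · have : f (MvPolynomial.X d) = MvPolynomial.X d := by simp [f, h]
        rw [SetLike.mem_coe, Subalgebra.mem_comap, this]
        exact MvPolynomial.X_mem_supported.2 (Finset.mem_erase.2 ⟨h, hd⟩)
    exact hle hp
  have hsub := (vertexDiags_subset_iff hT).2 hear
  have key := iterPDeriv_det Subtype.val_injective hA (nodup_vertexDiags n)
    (fun d hd hdT => (Finset.mem_sdiff.1 (hsub (List.mem_toFinset.2 hd))).2 hdT)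
    (fun d hd => ⟨⟨d, hsub (List.mem_toFinset.2 hd)⟩, rfl⟩)
  rw [← hdet, iterPDeriv_Adj hn, det_unitRows] at key
  let e : {i : {d // d ∈ diagonals (n + 1) \ T} // i.val ∉ (vertexDiags n).toFinset} ≃
      {d // d ∈ diagonals n \ T.erase (1, n)} :=
    (Equiv.subtypeSubtypeEquivSubtypeInter (· ∈ diagonals (n + 1) \ T)
      (· ∉ (vertexDiags n).toFinset)).trans
      (Equiv.subtypeEquivRight fun d => by rw [← hD, Finset.mem_sdiff (s := _ \ _)])
  refine HasAVRepAt.of_equiv (hT.erase_of_ear_last hn hear) e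
    ((A.submatrix Subtype.val Subtype.val).map f) (fun i j => hfsupp _ (hA _ _)) ?_
  rw [← hfAdj, key, map_det_diagonal_add]
  congr 3
  funext i
  exact hfX _ (Finset.mem_sdiff.1 (e i).2).1

theorem stmt_16 (n : ℕ) (hn : 4 ≤ n) :
    iterPDeriv (vertexDiags n) (Adj (n + 1)) = Adj n ∧
    (HasAVRep (n + 1) → HasAVRep n) := by
  refine ⟨iterPDeriv_Adj (by omega), ?_⟩
  rintro ⟨T, hT, hA⟩
  have hne : T.Nonempty := by
    rw [← Finset.card_pos, hT.1]
    omega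
  obtain ⟨T', -, hear, h'⟩ := hT.isNoncrossing.exists_ear_last (P := HasAVRepAt (n + 1))
    (fun _ _ h => h.rotate) hne ⟨hT, hA⟩
  exact ⟨T'.erase (1, n), h'.of_ear_last (by omega) hear⟩
end
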